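/- arXiv:2506.09328 — 2 statements merged into one kernel-verified Lean document; each statement's English description precedes it below -/
import Mathlib

section
/- Let H₁, H₂ be Hilbert spaces and c : H₁ → H₂ a compact linear map. Then the induced map t ↦ c t c* from trace-class operators N[H₁] to N[H₂] is compact, and it maps weak-* convergent sequences in N[H₁] to norm-convergent sequences in N[H₂]. -/
open Filter Topology
open scoped RealInnerProductSpace

noncomputable section

variable {H H₁ H₂ : Type*}

/-- Trace of an operator along a Hilbert basis. -/
def traceAlong [NormedAddCommGroup H] [InnerProductSpace ℝ H] {ι : Type*}
    (b : HilbertBasis ι ℝ H) (s : H →L[ℝ] H) : ℝ :=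
  ∑' i, ⟪s (b i), b i⟫

/-- `t` is nuclear (trace-class) with nuclear (projective) norm at most `C`:
it admits a representation `t = Σ xᵢ ⊗ yᵢ` with `Σ ‖xᵢ‖‖yᵢ‖ ≤ C`. -/
def IsNuclearWith [NormedAddCommGroup H₁] [InnerProductSpace ℝ H₁]
    [NormedAddCommGroup H₂] [InnerProductSpace ℝ H₂]
    (C : ℝ) (t : H₁ →L[ℝ] H₂) : Prop :=
  ∃ (x : ℕ → H₂) (y : ℕ → H₁),
    Summable (fun i => ‖x i‖ * ‖y i‖) ∧ (∑' i, ‖x i‖ * ‖y i‖) ≤ C ∧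
      ∀ z : H₁, HasSum (fun i => ⟪y i, z⟫ • x i) (t z)

/-- `t` is a nuclear (trace-class) operator. -/
def IsNuclear [NormedAddCommGroup H₁] [InnerProductSpace ℝ H₁]
    [NormedAddCommGroup H₂] [InnerProductSpace ℝ H₂] (t : H₁ →L[ℝ] H₂) : Prop :=
  ∃ C, IsNuclearWith C t

/-- The nuclear (trace/projective) norm of `t`. -/
def nuclearNorm [NormedAddCommGroup H₁] [InnerProductSpace ℝ H₁]
    [NormedAddCommGroup H₂] [InnerProductSpace ℝ H₂] (t : H₁ →L[ℝ] H₂) : ℝ :=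
  sInf {C | IsNuclearWith C t}

/-- Weak-* convergence in `N[H] = K[H]*`: testing against every compact operator `q`
via the trace pairing `(q,t) ↦ Tr(q t)`. -/
def WeakStarTendstoN [NormedAddCommGroup H] [InnerProductSpace ℝ H] {ι : Type*}
    (b : HilbertBasis ι ℝ H) (ts : ℕ → H →L[ℝ] H) (t : H →L[ℝ] H) : Prop :=
  ∀ q : H →L[ℝ] H, IsCompactOperator q →
    Tendsto (fun n => traceAlong b (q ∘L ts n)) atTop (𝓝 (traceAlong b (q ∘L t)))

end

section Nuclear

open InnerProductSpace ContinuousLinearMap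

variable {E F G K : Type*}
  [NormedAddCommGroup E] [InnerProductSpace ℝ E] [NormedAddCommGroup F] [InnerProductSpace ℝ F]
  [NormedAddCommGroup G] [InnerProductSpace ℝ G] [NormedAddCommGroup K] [InnerProductSpace ℝ K]

/-- A nuclear representation may be indexed by any countable type. -/
theorem IsNuclearWith.of_countable {κ : Type*} [Countable κ] {C : ℝ} {t : E →L[ℝ] F}
    (x : κ → F) (y : κ → E) (hs : Summable fun i => ‖x i‖ * ‖y i‖)
    (hC : ∑' i, ‖x i‖ * ‖y i‖ ≤ C) (ht : ∀ z, HasSum (fun i => ⟪y i, z⟫ • x i) (t z)) :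
    IsNuclearWith C t := by
  obtain ⟨f, hf⟩ := exists_injective_nat κ
  have key : (fun i => ‖Function.extend f x 0 i‖ * ‖Function.extend f y 0 i‖)
      = Function.extend f (fun i => ‖x i‖ * ‖y i‖) 0 := by
    funext i
    by_cases hi : ∃ a, f a = i
    · obtain ⟨a, rfl⟩ := hi
      simp [hf.extend_apply]
    · simp [Function.extend_apply' _ _ _ hi]
  have hsum := (hasSum_extend_zero hf).2 hs.hasSum
  refine ⟨Function.extend f x 0, Function.extend f y 0, ?_, ?_, fun z => ?_⟩
  · rw [key]; exact hsum.summable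
  · rw [key, hsum.tsum_eq]; exact hC
  · have : (fun i => ⟪Function.extend f y 0 i, z⟫ • Function.extend f x 0 i)
        = Function.extend f (fun i => ⟪y i, z⟫ • x i) 0 := by
      funext i
      by_cases hi : ∃ a, f a = i
      · obtain ⟨a, rfl⟩ := hi
        simp [hf.extend_apply]
      · simp [Function.extend_apply' _ _ _ hi]
    rw [this]
    exact (hasSum_extend_zero hf).2 (ht z)

theorem IsNuclearWith.mono {C D : ℝ} {t : E →L[ℝ] F} (ht : IsNuclearWith C t) (h : C ≤ D) :
    IsNuclearWith D t := by
  obtain ⟨x, y, hs, hC, hz⟩ := ht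
  exact ⟨x, y, hs, hC.trans h, hz⟩

theorem IsNuclearWith.nonneg {C : ℝ} {t : E →L[ℝ] F} (ht : IsNuclearWith C t) : 0 ≤ C := by
  obtain ⟨x, y, -, hC, -⟩ := ht
  exact (tsum_nonneg fun i => by positivity).trans hC

theorem IsNuclearWith.add {C D : ℝ} {s t : E →L[ℝ] F} (hs : IsNuclearWith C s)
    (ht : IsNuclearWith D t) : IsNuclearWith (C + D) (s + t) := by
  obtain ⟨x, y, h1, h2, h3⟩ := hs
  obtain ⟨x', y', h1', h2', h3'⟩ := ht
  have hsum : HasSum (fun i => ‖Sum.elim x x' i‖ * ‖Sum.elim y y' i‖)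
      ((∑' i, ‖x i‖ * ‖y i‖) + ∑' i, ‖x' i‖ * ‖y' i‖) := HasSum.sum h1.hasSum h1'.hasSum
  refine .of_countable (Sum.elim x x') (Sum.elim y y') hsum.summable ?_ fun z => ?_
  · rw [hsum.tsum_eq]; exact add_le_add h2 h2'
  · exact HasSum.sum (h3 z) (h3' z)

theorem IsNuclearWith.neg {C : ℝ} {t : E →L[ℝ] F} (ht : IsNuclearWith C t) :
    IsNuclearWith C (-t) := by
  obtain ⟨x, y, h1, h2, h3⟩ := ht
  exact ⟨fun i => -x i, y, by simpa using h1, by simpa using h2,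
    fun z => by simpa using (h3 z).neg⟩

theorem IsNuclearWith.sub {C D : ℝ} {s t : E →L[ℝ] F} (hs : IsNuclearWith C s)
    (ht : IsNuclearWith D t) : IsNuclearWith (C + D) (s - t) := by
  rw [sub_eq_add_neg]; exact hs.add ht.neg

theorem IsNuclearWith.comp [CompleteSpace E] [CompleteSpace K] {C : ℝ} {t : E →L[ℝ] F}
    (ht : IsNuclearWith C t) (a : F →L[ℝ] G) (b : K →L[ℝ] E) :
    IsNuclearWith (‖a‖ * ‖b‖ * C) (a ∘L t ∘L b) := by
  obtain ⟨x, y, h1, h2, h3⟩ := ht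
  have hle : ∀ i, ‖a (x i)‖ * ‖adjoint b (y i)‖ ≤ ‖a‖ * ‖b‖ * (‖x i‖ * ‖y i‖) := fun i => by
    calc _ ≤ (‖a‖ * ‖x i‖) * (‖adjoint b‖ * ‖y i‖) := by gcongr <;> apply le_opNorm
      _ = _ := by rw [LinearIsometryEquiv.norm_map]; ring
  have hs : Summable fun i => ‖a (x i)‖ * ‖adjoint b (y i)‖ :=
    .of_nonneg_of_le (fun i => by positivity) hle (h1.mul_left _)
  refine ⟨fun i => a (x i), fun i => adjoint b (y i), hs, ?_, fun z => ?_⟩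
  · calc _ ≤ ∑' i, ‖a‖ * ‖b‖ * (‖x i‖ * ‖y i‖) := hs.tsum_le_tsum hle (h1.mul_left _)
      _ = ‖a‖ * ‖b‖ * ∑' i, ‖x i‖ * ‖y i‖ := tsum_mul_left
      _ ≤ _ := by gcongr
  · simpa [adjoint_inner_left, Function.comp_def] using (h3 (b z)).mapL a

theorem isNuclearWith_sum_rankOne {κ : Type*} [Fintype κ] (x : κ → F) (y : κ → E) :
    IsNuclearWith (∑ i, ‖x i‖ * ‖y i‖) (∑ i, rankOne ℝ (x i) (y i)) := by
  refine .of_countable x y (Summable.of_finite) (by rw [tsum_fintype]) fun z => ?_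
  simpa using hasSum_fintype (fun i => ⟪y i, z⟫ • x i)

theorem nuclearNorm_nonneg (t : E →L[ℝ] F) : 0 ≤ nuclearNorm t :=
  Real.sInf_nonneg fun _ h => IsNuclearWith.nonneg h

theorem IsNuclearWith.nuclearNorm_le {C : ℝ} {t : E →L[ℝ] F} (ht : IsNuclearWith C t) :
    nuclearNorm t ≤ C :=
  csInf_le ⟨0, fun _ h => IsNuclearWith.nonneg h⟩ ht

/-- The operator norm is bounded by the nuclear norm. -/
theorem IsNuclearWith.norm_apply_le {C : ℝ} {t : E →L[ℝ] F} (ht : IsNuclearWith C t) (z : E) :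
    ‖t z‖ ≤ C * ‖z‖ := by
  obtain ⟨x, y, h1, h2, h3⟩ := ht
  rw [← (h3 z).tsum_eq]
  calc _ ≤ ∑' i, ‖x i‖ * ‖y i‖ * ‖z‖ := by
        refine tsum_of_norm_bounded (h1.mul_right ‖z‖).hasSum fun i => ?_
        rw [norm_smul, mul_comm, mul_assoc]
        gcongr
        exact norm_inner_le_norm _ _
    _ = (∑' i, ‖x i‖ * ‖y i‖) * ‖z‖ := tsum_mul_right
    _ ≤ _ := by gcongr

/-- A compact operator into a Hilbert space is approximated in norm by its compositions with
orthogonal projections onto finite-dimensional subspaces. -/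
theorem IsCompactOperator.exists_finite_projection_approx {c : E →L[ℝ] F}
    (hc : IsCompactOperator c) {ε : ℝ} (hε : 0 < ε) :
    ∃ (V : Submodule ℝ F) (_ : FiniteDimensional ℝ V), ‖c - V.starProjection ∘L c‖ ≤ ε := by
  obtain ⟨S, hS, hsub⟩ := hc.image_closedBall_subset_compact (𝕜₁ := ℝ) (f := c.toLinearMap) 1
  obtain ⟨s, hs, hcov⟩ := Metric.totallyBounded_iff.1 hS.totallyBounded ε hε
  have : FiniteDimensional ℝ (Submodule.span ℝ s) := FiniteDimensional.span_of_finite ℝ hs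
  refine ⟨Submodule.span ℝ s, this, opNorm_le_of_unit_norm hε.le fun z hz => ?_⟩
  have hz' : c z ∈ S := hsub ⟨z, by simp [hz], rfl⟩
  obtain ⟨w, hw, hwz⟩ := Set.mem_iUnion₂.1 (hcov hz')
  have hmin := Submodule.starProjection_minimal (U := Submodule.span ℝ s) (c z)
  calc _ = ‖c z - (Submodule.span ℝ s).starProjection (c z)‖ := rfl
    _ ≤ ‖c z - w‖ := by
      rw [hmin]
      exact ciInf_le ⟨0, by rintro _ ⟨v, rfl⟩; positivity⟩
        (⟨w, Submodule.subset_span hw⟩ : Submodule.span ℝ s)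
    _ ≤ ε := by rw [← dist_eq_norm]; exact (Metric.mem_ball.1 hwz).le

/-- The nuclear norm of `c t c*` is controlled by a small multiple of the nuclear norm of `t`
plus finitely many matrix coefficients of `t`. -/
theorem IsCompactOperator.exists_isNuclearWith_conj [CompleteSpace E] [CompleteSpace F]
    {c : E →L[ℝ] F} (hc : IsCompactOperator c) {ε : ℝ} (hε : 0 < ε) :
    ∃ (n : ℕ) (g : Fin n → E), ∀ (t : E →L[ℝ] E) (C : ℝ), IsNuclearWith C t →
      IsNuclearWith (ε * C + ∑ p : Fin n × Fin n, |⟪g p.1, t (g p.2)⟫|)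
        (c ∘L t ∘L adjoint c) := by
  obtain ⟨V, hV, hVc⟩ := hc.exists_finite_projection_approx
    (ε := ε / (2 * (‖c‖ + 1))) (by positivity)
  set Q := V.starProjection with hQ
  set f := stdOrthonormalBasis ℝ V
  refine ⟨_, fun i => adjoint c (f i), fun t C ht => ?_⟩
  have hQa : adjoint Q = Q := isSelfAdjoint_starProjection V
  have h1 := ht.comp (c - Q ∘L c) (adjoint c)
  have h2 := ht.comp (Q ∘L c) (adjoint (c - Q ∘L c))
  have h3 := isNuclearWith_sum_rankOne
    (fun p : Fin (Module.finrank ℝ V) × Fin (Module.finrank ℝ V) =>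
      ⟪adjoint c (f p.1), t (adjoint c (f p.2))⟫ • (f p.1 : F)) (fun p => (f p.2 : F))
  have hn : ∀ i, ‖(f i : F)‖ = 1 := fun i => f.orthonormal.1 i
  simp only [norm_smul, hn, mul_one, Real.norm_eq_abs] at h3
  have heq : c ∘L t ∘L adjoint c = (c - Q ∘L c) ∘L t ∘L adjoint c
      + (Q ∘L c) ∘L t ∘L adjoint (c - Q ∘L c) +
      ∑ p : Fin (Module.finrank ℝ V) × Fin (Module.finrank ℝ V), rankOne ℝ
        (⟪adjoint c (f p.1), t (adjoint c (f p.2))⟫ • (f p.1 : F)) (f p.2 : F) := by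
    have hproj : ∀ z, Q z = ∑ i, ⟪(f i : F), z⟫ • (f i : F) := fun z => by
      rw [hQ, f.starProjection_eq_sum_rankOne]; simp
    have hsum : ∑ p : Fin (Module.finrank ℝ V) × Fin (Module.finrank ℝ V), rankOne ℝ
        (⟪adjoint c (f p.1), t (adjoint c (f p.2))⟫ • (f p.1 : F)) (f p.2 : F)
        = (Q ∘L c) ∘L t ∘L adjoint c ∘L Q := by
      ext z
      simp only [comp_apply]
      rw [hproj (c _), hproj z]
      simp only [map_sum, map_smul, inner_sum, inner_smul_right, Finset.sum_smul,
        Fintype.sum_prod_type, adjoint_inner_left, sum_apply, smul_apply, rankOne_apply, smul_smul]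
      exact Finset.sum_congr rfl fun _ _ => Finset.sum_congr rfl fun _ _ => by rw [mul_comm]
    rw [hsum, map_sub, adjoint_comp, hQa]
    ext z
    simp
  rw [heq]
  refine ((h1.add h2).add h3).mono ?_
  have hC := ht.nonneg
  have hQc : ‖Q ∘L c‖ ≤ ‖c‖ := (opNorm_comp_le _ _).trans
    (mul_le_of_le_one_left (norm_nonneg _) V.starProjection_norm_le)
  rw [LinearIsometryEquiv.norm_map, LinearIsometryEquiv.norm_map]
  gcongr ?_ + _
  calc _ ≤ ε / (2 * (‖c‖ + 1)) * ‖c‖ * C + ‖c‖ * (ε / (2 * (‖c‖ + 1))) * C := by gcongr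
    _ = ε * C * (‖c‖ / (‖c‖ + 1)) := by field_simp; ring
    _ ≤ ε * C * 1 := by
      gcongr
      rw [div_le_one (by positivity)]; linarith
    _ = _ := mul_one _

theorem isCompactOperator_rankOne (x : F) (y : E) : IsCompactOperator (rankOne ℝ x y) :=
  IsCompactOperator.clm_comp (f := (innerSL ℝ y).toLinearMap)
    (isCompactOperator_of_locallyCompactSpace_dom (innerSL ℝ y)) (toSpanSingleton ℝ x)

theorem norm_sum_smul_sq_of_pairwise_orthogonal {κ : Type*} [Fintype κ] (v : κ → E)
    (hv : ∀ i j, i ≠ j → ⟪v i, v j⟫ = 0) (a : κ → ℝ) :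
    ‖∑ i, a i • v i‖ ^ 2 = ∑ i, a i ^ 2 * ‖v i‖ ^ 2 := by
  rw [← real_inner_self_eq_norm_sq, sum_inner]
  refine Finset.sum_congr rfl fun i _ => ?_
  rw [inner_sum, Finset.sum_eq_single i]
  · rw [real_inner_smul_left, real_inner_smul_right, real_inner_self_eq_norm_sq]; ring
  · intro j _ hj
    rw [real_inner_smul_left, real_inner_smul_right, hv i j hj.symm]; simp
  · simp

/-- A finite sum of rank-one operators is normed by a contraction of finite rank. -/
theorem exists_compact_contraction_sum_rankOne [CompleteSpace E] {κ : Type*} [Fintype κ]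
    (x y : κ → E) :
    ∃ q : E →L[ℝ] E, IsCompactOperator q ∧ ‖q‖ ≤ 1 ∧
      IsNuclearWith (∑ k, ⟪y k, q (x k)⟫) (∑ k, rankOne ℝ (x k) (y k)) := by
  set t := ∑ k, rankOne ℝ (x k) (y k) with ht
  have htap : ∀ z, t z = ∑ k, ⟪y k, z⟫ • x k := fun z => by simp [ht]
  set V := Submodule.span ℝ (Set.range y)
  have : FiniteDimensional ℝ V := FiniteDimensional.span_of_finite ℝ (Set.finite_range y)
  let T : V →L[ℝ] E := t ∘L V.subtypeL
  let A : V →ₗ[ℝ] V := (adjoint T ∘L T).toLinearMap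
  have hA : ∀ v w, ⟪A v, w⟫ = ⟪T v, T w⟫ := fun v w => adjoint_inner_left T w (T v)
  have hAs : A.IsSymmetric := fun v w => by
    rw [hA, real_inner_comm, ← hA, real_inner_comm]
  let e := hAs.eigenvectorBasis rfl
  have heV : ∀ i j, i ≠ j → ⟪(e i : E), e j⟫ = 0 := fun i j hij => e.orthonormal.2 hij
  have horth : ∀ i j, i ≠ j → ⟪T (e i), T (e j)⟫ = 0 := fun i j hij => by
    rw [← hA, hAs.apply_eigenvectorBasis, real_inner_smul_left]
    exact mul_eq_zero_of_right _ (heV i j hij)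
  have htz : ∀ z, t z = ∑ i, ⟪(e i : E), z⟫ • T (e i) := fun z => by
    have h1 : t z = t (V.starProjection z) := by
      rw [htap, htap]
      refine Finset.sum_congr rfl fun k _ => ?_
      have hy : y k ∈ V := Submodule.subset_span ⟨k, rfl⟩
      rw [← V.inner_starProjection_left_eq_right, V.starProjection_eq_self_iff.2 hy]
    rw [h1, e.starProjection_eq_sum_rankOne]
    simp [T]
  let u := fun i => ‖T (e i)‖⁻¹ • T (e i)
  have huo : ∀ i j, i ≠ j → ⟪u i, u j⟫ = 0 := fun i j hij => by
    simp [u, real_inner_smul_left, real_inner_smul_right, horth i j hij]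
  have hu1 : ∀ i, ‖u i‖ ≤ 1 := fun i => by
    simp only [u, norm_smul, norm_inv, norm_norm]
    exact inv_mul_le_one
  refine ⟨∑ i, rankOne ℝ (e i : E) (u i), ?_, ?_, ?_⟩
  · exact (compactOperator (RingHom.id ℝ) E E).sum_mem fun i _ => isCompactOperator_rankOne _ _
  · refine opNorm_le_bound _ zero_le_one fun z => ?_
    rw [one_mul]
    refine le_of_sq_le_sq ?_ (norm_nonneg z)
    have h1 := norm_sum_smul_sq_of_pairwise_orthogonal (fun i => (e i : E)) heV
      (fun i => ⟪u i, z⟫)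
    have h2 := norm_sum_smul_sq_of_pairwise_orthogonal u huo (fun i => ⟪u i, z⟫)
    have hn : ∀ i, ‖(e i : E)‖ = 1 := fun i => e.orthonormal.1 i
    simp only [hn, one_pow, mul_one] at h1
    have h3 : ‖∑ i, ⟪u i, z⟫ • u i‖ ^ 2 ≤ ∑ i, ⟪u i, z⟫ ^ 2 := by
      rw [h2]
      refine Finset.sum_le_sum fun i _ => mul_le_of_le_one_right (sq_nonneg _) ?_
      exact pow_le_one₀ (norm_nonneg _) (hu1 i)
    have h4 : ⟪z, ∑ i, ⟪u i, z⟫ • u i⟫ = ∑ i, ⟪u i, z⟫ ^ 2 := by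
      rw [inner_sum]
      refine Finset.sum_congr rfl fun i _ => ?_
      rw [real_inner_smul_right, real_inner_comm, sq]
    have h5 := norm_sub_sq_real z (∑ i, ⟪u i, z⟫ • u i)
    simp only [sum_apply, rankOne_apply]
    nlinarith [sq_nonneg ‖z - ∑ i, ⟪u i, z⟫ • u i‖]
  · have h1 : t = ∑ i, rankOne ℝ (T (e i)) (e i : E) := by
      ext z
      rw [htz]; simp
    have h2 : ∑ k, ⟪y k, (∑ i, rankOne ℝ (e i : E) (u i)) (x k)⟫
        = ∑ i, ‖T (e i)‖ * ‖(e i : E)‖ := by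
      simp only [sum_apply, rankOne_apply, inner_sum, real_inner_smul_right]
      rw [Finset.sum_comm]
      refine Finset.sum_congr rfl fun i _ => ?_
      have hn : ‖(e i : E)‖ = 1 := e.orthonormal.1 i
      have h3 : T (e i) = ∑ k, ⟪y k, (e i : E)⟫ • x k := htap _
      calc _ = ⟪u i, T (e i)⟫ := by
            rw [h3, inner_sum]
            refine Finset.sum_congr rfl fun k _ => ?_
            rw [real_inner_smul_right, mul_comm]
        _ = _ := by
            simp only [u]
            rw [real_inner_smul_left, real_inner_self_eq_norm_sq, hn, mul_one, sq, ← mul_assoc]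
            by_cases h0 : ‖T (e i)‖ = 0
            · simp [h0]
            · rw [inv_mul_cancel₀ h0, one_mul]
    rw [h2, h1]
    exact isNuclearWith_sum_rankOne _ _

theorem HilbertBasis.sum_abs_inner_mul_inner_le {ι : Type*} (b : HilbertBasis ι ℝ E) (v w : E)
    (s : Finset ι) : ∑ i ∈ s, |⟪v, b i⟫ * ⟪w, b i⟫| ≤ ‖v‖ * ‖w‖ := by
  have bessel : ∀ v : E, √(∑ i ∈ s, |⟪v, b i⟫| ^ 2) ≤ ‖v‖ := fun v => by
    rw [Real.sqrt_le_left (norm_nonneg v)]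
    simpa [real_inner_comm] using b.orthonormal.sum_inner_products_le v (s := s)
  simp only [abs_mul]
  exact (Real.sum_mul_le_sqrt_mul_sqrt _ _ _).trans
    (mul_le_mul (bessel v) (bessel w) (by positivity) (by positivity))

/-- The trace of `q t` along any Hilbert basis, in terms of a nuclear representation of `t`. -/
theorem traceAlong_comp_eq_tsum {ι : Type*} (b : HilbertBasis ι ℝ E) {t : E →L[ℝ] E}
    {x y : ℕ → E} (hs : Summable fun k => ‖x k‖ * ‖y k‖)
    (ht : ∀ z, HasSum (fun k => ⟪y k, z⟫ • x k) (t z)) (q : E →L[ℝ] E) :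
    traceAlong b (q ∘L t) = ∑' k, ⟪y k, q (x k)⟫ := by
  have h1 : ∀ i, ⟪(q ∘L t) (b i), b i⟫ = ∑' k, ⟪y k, b i⟫ * ⟪q (x k), b i⟫ := fun i => by
    have := ((ht (b i)).mapL q).mapL (innerSL ℝ (b i))
    rw [real_inner_comm]
    refine (this.tsum_eq.symm.trans (tsum_congr fun k => ?_))
    simp [real_inner_comm]
  have habs : Summable fun p : ℕ × ι => |⟪y p.1, b p.2⟫ * ⟪q (x p.1), b p.2⟫| := by
    refine (summable_prod_of_nonneg fun _ => abs_nonneg _).2 ⟨fun k => ?_, ?_⟩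
    · exact summable_of_sum_le (fun _ => abs_nonneg _)
        (b.sum_abs_inner_mul_inner_le (y k) (q (x k)))
    · refine .of_nonneg_of_le (fun k => tsum_nonneg fun _ => abs_nonneg _) (fun k => ?_)
        (hs.mul_left ‖q‖)
      refine (Real.tsum_le_of_sum_le (fun _ => abs_nonneg _)
        (b.sum_abs_inner_mul_inner_le (y k) (q (x k)))).trans ?_
      calc _ ≤ ‖y k‖ * (‖q‖ * ‖x k‖) := by gcongr; apply le_opNorm
        _ = _ := by ring
  have hcomm : ∑' i, ∑' k, ⟪y k, b i⟫ * ⟪q (x k), b i⟫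
      = ∑' k, ∑' i, ⟪y k, b i⟫ * ⟪q (x k), b i⟫ :=
    Summable.tsum_comm (f := fun k i => ⟪y k, b i⟫ * ⟪q (x k), b i⟫) habs.of_abs
  rw [traceAlong, tsum_congr h1, hcomm]
  refine tsum_congr fun k => ?_
  rw [← b.tsum_inner_mul_inner]
  exact tsum_congr fun i => by rw [real_inner_comm (q (x k))]

theorem IsNuclear.traceAlong_rankOne_comp {ι : Type*} (b : HilbertBasis ι ℝ E) {t : E →L[ℝ] E}
    (ht : IsNuclear t) (v w : E) : traceAlong b (rankOne ℝ v w ∘L t) = ⟪w, t v⟫ := by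
  obtain ⟨_, x, y, hs, -, hz⟩ := ht
  rw [traceAlong_comp_eq_tsum b hs hz]
  refine (tsum_congr fun k => ?_).trans ((hz v).mapL (innerSL ℝ w)).tsum_eq
  simp [real_inner_smul_right, mul_comm]

/-- For nuclear `t`, the trace pairing `q ↦ Tr (q t)` is a bounded linear functional. -/
theorem IsNuclear.exists_tracePairing {ι : Type*} (b : HilbertBasis ι ℝ E) {t : E →L[ℝ] E}
    (ht : IsNuclear t) :
    ∃ φ : (E →L[ℝ] E) →L[ℝ] ℝ, ∀ q, φ q = traceAlong b (q ∘L t) := by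
  obtain ⟨_, x, y, hs, -, hz⟩ := ht
  have hle : ∀ (q : E →L[ℝ] E) k, ‖⟪y k, q (x k)⟫‖ ≤ ‖q‖ * (‖x k‖ * ‖y k‖) := fun q k =>
    calc _ ≤ ‖y k‖ * (‖q‖ * ‖x k‖) :=
          (norm_inner_le_norm _ _).trans (by gcongr; apply le_opNorm)
      _ = _ := by ring
  have hsum : ∀ q : E →L[ℝ] E, Summable fun k => ⟪y k, q (x k)⟫ := fun q =>
    .of_norm_bounded (hs.mul_left _) (hle q)
  let f : (E →L[ℝ] E) →ₗ[ℝ] ℝ :=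
    { toFun := fun q => ∑' k, ⟪y k, q (x k)⟫
      map_add' := fun p q => by
        simp only [add_apply, inner_add_right]
        exact (hsum p).tsum_add (hsum q)
      map_smul' := fun a q => by
        simp only [smul_apply, real_inner_smul_right, tsum_mul_left, RingHom.id_apply, smul_eq_mul] }
  refine ⟨f.mkContinuous (∑' k, ‖x k‖ * ‖y k‖) fun q => ?_, fun q => ?_⟩
  · rw [mul_comm, ← tsum_mul_left]
    exact tsum_of_norm_bounded (hs.mul_left _).hasSum (hle q)
  · rw [traceAlong_comp_eq_tsum b hs hz]
    rfl

/-- The nuclear norm is dual to the operator norm on compact operators. -/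
theorem IsNuclear.isNuclearWith_of_traceAlong_le [CompleteSpace E] {ι : Type*}
    (b : HilbertBasis ι ℝ E) {t : E →L[ℝ] E} (ht : IsNuclear t) {M : ℝ}
    (hM : ∀ q : E →L[ℝ] E, IsCompactOperator q → ‖q‖ ≤ 1 → traceAlong b (q ∘L t) ≤ M)
    {ε : ℝ} (hε : 0 < ε) : IsNuclearWith (M + ε) t := by
  obtain ⟨_, x, y, hs, -, hz⟩ := ht
  obtain ⟨N, hN⟩ := ((tendsto_sum_nat_add fun k => ‖x k‖ * ‖y k‖).eventually
    (gt_mem_nhds (half_pos hε))).exists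
  obtain ⟨q, hq, hq1, hqN⟩ := exists_compact_contraction_sum_rankOne
    (fun k : Fin N => x k) (fun k => y k)
  have hstail : Summable fun k => ‖x (k + N)‖ * ‖y (k + N)‖ := (summable_nat_add_iff N).2 hs
  have htail : IsNuclearWith (ε / 2) (t - ∑ k : Fin N, rankOne ℝ (x k) (y k)) := by
    refine ⟨fun k => x (k + N), fun k => y (k + N), hstail, hN.le, fun z => ?_⟩
    have := (hasSum_nat_add_iff' N).2 (hz z)
    simpa [Finset.sum_range] using this
  have hle : ∀ k, ‖⟪y k, q (x k)⟫‖ ≤ ‖x k‖ * ‖y k‖ := fun k =>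
    calc _ ≤ ‖y k‖ * (1 * ‖x k‖) :=
          (norm_inner_le_norm _ _).trans (by gcongr; exact q.le_of_opNorm_le hq1 _)
      _ = _ := by ring
  have hsum : Summable fun k => ⟪y k, q (x k)⟫ := .of_norm_bounded hs hle
  have hrest : |∑' k, ⟪y (k + N), q (x (k + N))⟫| ≤ ε / 2 :=
    (tsum_of_norm_bounded hstail.hasSum fun k => hle (k + N)).trans hN.le
  have hT := hM q hq hq1
  rw [traceAlong_comp_eq_tsum b hs hz, ← hsum.sum_add_tsum_nat_add N, Finset.sum_range] at hT
  have := (hqN.mono (D := M + ε / 2) (by linarith [(abs_le.1 hrest).1])).add htail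
  rw [add_sub_cancel] at this
  exact this.mono (by linarith)

/-- Uniform boundedness: a weak-* convergent sequence is bounded in nuclear norm. -/
theorem WeakStarTendstoN.exists_isNuclearWith [CompleteSpace E] {ι : Type*}
    {b : HilbertBasis ι ℝ E} {ts : ℕ → E →L[ℝ] E} {t : E →L[ℝ] E}
    (h : WeakStarTendstoN b ts t) (hts : ∀ n, IsNuclear (ts n)) :
    ∃ C, ∀ n, IsNuclearWith C (ts n) := by
  choose φ hφ using fun n => (hts n).exists_tracePairing b
  let W : Submodule ℝ (E →L[ℝ] E) := compactOperator (RingHom.id ℝ) E E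
  have : CompleteSpace W := isClosed_setOfPred_isCompactOperator.completeSpace_coe
  have hbdd : ∀ q : W, ∃ D, ∀ n, ‖(φ n ∘L W.subtypeL) q‖ ≤ D := fun q => by
    obtain ⟨D, hD⟩ := (h q q.2).norm.bddAbove_range
    refine ⟨D, fun n => ?_⟩
    rw [comp_apply, W.subtypeL_apply, hφ]
    exact hD ⟨n, rfl⟩
  obtain ⟨C, hC⟩ := banach_steinhaus (E := W) (F := ℝ) (g := fun n => φ n ∘L W.subtypeL) hbdd
  refine ⟨C + 1, fun n => (hts n).isNuclearWith_of_traceAlong_le b (fun q hq hq1 => ?_) one_pos⟩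
  rw [← hφ]
  have hle := ContinuousLinearMap.le_of_opNorm_le _ (hC n) (⟨q, hq⟩ : W)
  exact (le_abs_self _).trans (hle.trans
    (mul_le_of_le_one_right ((norm_nonneg _).trans (hC n)) hq1))

/-- Conjugating with a compact operator turns weak operator convergence to zero of a family that
is bounded in nuclear norm into convergence in nuclear norm. -/
theorem IsCompactOperator.tendsto_nuclearNorm_conj [CompleteSpace E] [CompleteSpace F]
    {c : E →L[ℝ] F} (hc : IsCompactOperator c) {s : ℕ → E →L[ℝ] E} {C : ℝ}
    (hs : ∀ n, IsNuclearWith C (s n)) (h : ∀ v w, Tendsto (fun n => ⟪w, s n v⟫) atTop (𝓝 0)) :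
    Tendsto (fun n => nuclearNorm (c ∘L s n ∘L adjoint c)) atTop (𝓝 0) := by
  refine tendsto_order.2 ⟨fun a ha => .of_forall fun n => ha.trans_le (nuclearNorm_nonneg _),
    fun ε hε => ?_⟩
  have hC : 0 ≤ C := (hs 0).nonneg
  obtain ⟨k, g, hg⟩ := hc.exists_isNuclearWith_conj (ε := ε / (2 * (C + 1))) (by positivity)
  have hlim : Tendsto (fun n => ∑ p : Fin k × Fin k, |⟪g p.1, s n (g p.2)⟫|) atTop (𝓝 0) := by
    simpa using tendsto_finsetSum Finset.univ
      fun (p : Fin k × Fin k) _ => (h (g p.2) (g p.1)).abs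
  have hsmall : ε / (2 * (C + 1)) * C ≤ ε / 2 := by
    rw [div_mul_eq_mul_div, div_le_div_iff₀ (by positivity) two_pos]
    nlinarith
  filter_upwards [hlim.eventually (gt_mem_nhds (half_pos hε))] with n hn
  linarith [(hg _ _ (hs n)).nuclearNorm_le]

/-- Every sequence bounded in nuclear norm has a subsequence whose conjugates by a compact
operator are Cauchy in nuclear norm. -/
theorem IsCompactOperator.exists_subseq_cauchy_conj [CompleteSpace E] [CompleteSpace F]
    {c : E →L[ℝ] F} (hc : IsCompactOperator c) {ts : ℕ → E →L[ℝ] E} {C : ℝ}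
    (hts : ∀ n, IsNuclearWith C (ts n)) :
    ∃ ψ : ℕ → ℕ, StrictMono ψ ∧ ∀ ε > (0 : ℝ), ∃ N : ℕ, ∀ j l : ℕ, N ≤ j → N ≤ l →
      nuclearNorm (c ∘L (ts (ψ j) - ts (ψ l)) ∘L adjoint c) < ε := by
  choose k g hg using fun m : ℕ => hc.exists_isNuclearWith_conj
    (Nat.one_div_pos_of_nat (α := ℝ) (n := m))
  let a : ℕ → (Σ m, Fin (k m) × Fin (k m)) → ℝ := fun n p =>
    ⟪g p.1 p.2.1, ts n (g p.1 p.2.2)⟫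
  have ha : ∀ n, a n ∈ Set.pi Set.univ fun p : Σ m, Fin (k m) × Fin (k m) =>
      Set.Icc (-(‖g p.1 p.2.1‖ * (C * ‖g p.1 p.2.2‖))) (‖g p.1 p.2.1‖ * (C * ‖g p.1 p.2.2‖)) :=
    fun n p _ => abs_le.1 ((abs_real_inner_le_norm _ _).trans
      (by gcongr; exact (hts n).norm_apply_le _))
  obtain ⟨L, -, ψ, hψ, hL⟩ := (isCompact_univ_pi fun _ => isCompact_Icc).tendsto_subseq ha
  rw [tendsto_pi_nhds] at hL
  refine ⟨ψ, hψ, fun ε hε => ?_⟩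
  have hC : 0 ≤ C := (hts 0).nonneg
  obtain ⟨m, hm⟩ := exists_nat_one_div_lt (show 0 < ε / (2 * (C + C + 1)) by positivity)
  have hlim : Tendsto (fun r : ℕ × ℕ => ∑ p : Fin (k m) × Fin (k m),
      |⟪g m p.1, (ts (ψ r.1) - ts (ψ r.2)) (g m p.2)⟫|) (atTop ×ˢ atTop) (𝓝 0) := by
    have := tendsto_finsetSum Finset.univ fun (p : Fin (k m) × Fin (k m)) _ =>
      (((hL ⟨m, p⟩).comp (tendsto_fst (f := atTop) (g := atTop))).sub
        ((hL ⟨m, p⟩).comp (tendsto_snd (f := atTop) (g := atTop)))).abs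
    simpa [a, inner_sub_right] using this
  have hev := hlim.eventually (gt_mem_nhds (half_pos hε))
  rw [prod_atTop_atTop_eq, eventually_atTop_prod_self'] at hev
  obtain ⟨N, hN⟩ := hev
  refine ⟨N, fun j l hj hl => ?_⟩
  have hsmall : 1 / ((m : ℝ) + 1) * (C + C) ≤ ε / 2 :=
    calc _ ≤ ε / (2 * (C + C + 1)) * (C + C) := by gcongr
      _ ≤ ε / 2 := by
        rw [div_mul_eq_mul_div, div_le_div_iff₀ (by positivity) two_pos]
        nlinarith
  linarith [(hg m _ _ ((hts (ψ j)).sub (hts (ψ l)))).nuclearNorm_le, hN j hj l hl]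

end Nuclear

/- STATEMENT 4: for compact `c : H₁ → H₂`, the induced map `t ↦ c t c*` on trace-class
operators is compact (bounded sequences have subsequences whose images are Cauchy in
nuclear norm), and it maps weak-* convergent sequences to nuclear-norm convergent ones. -/
theorem nuclear_pushforward_compact
    [NormedAddCommGroup H₁] [InnerProductSpace ℝ H₁] [CompleteSpace H₁]
    [NormedAddCommGroup H₂] [InnerProductSpace ℝ H₂] [CompleteSpace H₂]
    {ι₁ : Type*} (b₁ : HilbertBasis ι₁ ℝ H₁)
    (c : H₁ →L[ℝ] H₂) (hc : IsCompactOperator c) :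
    (∀ (ts : ℕ → H₁ →L[ℝ] H₁) (C : ℝ), (∀ n, IsNuclearWith C (ts n)) →
      ∃ ψ : ℕ → ℕ, StrictMono ψ ∧ ∀ ε > (0:ℝ), ∃ N : ℕ, ∀ j l : ℕ, N ≤ j → N ≤ l →
        nuclearNorm (c ∘L ts (ψ j) ∘L ContinuousLinearMap.adjoint c
          - c ∘L ts (ψ l) ∘L ContinuousLinearMap.adjoint c) < ε)
    ∧ ∀ (ts : ℕ → H₁ →L[ℝ] H₁) (t : H₁ →L[ℝ] H₁),
        (∀ n, IsNuclear (ts n)) → IsNuclear t →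
        WeakStarTendstoN b₁ ts t →
        Filter.Tendsto (fun n => nuclearNorm (c ∘L ts n ∘L ContinuousLinearMap.adjoint c
          - c ∘L t ∘L ContinuousLinearMap.adjoint c)) Filter.atTop (nhds 0) := by
  have hconj : ∀ s t : H₁ →L[ℝ] H₁, c ∘L s ∘L ContinuousLinearMap.adjoint c
      - c ∘L t ∘L ContinuousLinearMap.adjoint c
      = c ∘L (s - t) ∘L ContinuousLinearMap.adjoint c := fun s t => by ext; simp
  simp only [hconj]
  refine ⟨fun ts C hts => hc.exists_subseq_cauchy_conj hts, fun ts t hts ht h => ?_⟩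
  obtain ⟨C, hC⟩ := h.exists_isNuclearWith hts
  have ⟨D, hD⟩ := ht
  refine hc.tendsto_nuclearNorm_conj (fun n => (hC n).sub hD) fun v w => ?_
  have hw := h _ (isCompactOperator_rankOne v w)
  simp only [(hts _).traceAlong_rankOne_comp b₁, ht.traceAlong_rankOne_comp b₁] at hw
  simpa [inner_sub_right] using hw.sub_const ⟪w, t v⟫
end

section
/- For the (positive, compact, self-adjoint) operator setting with eigenvalues indexed in decreasing order λ₁ ≥ λ₂ ≥ ..., if T is a positive compact self-adjoint operator on a Hilbert space H with λ_k(T) > 0, then λ_k : K_sa[H] → R is Lipschitz on a neighborhood of T, and its Clarke subdifferential is ∂_C λ_k(T) = conv{ φ⊗φ : φ ∈ E_k(T), ‖φ‖ = 1 }, where E_k(T) is the eigenspace of T for the eigenvalue λ_k(T). -/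
/- Clarke subdifferential of the `k`-th eigenvalue (eigenvalues in decreasing order,
counted with multiplicity, `k` starting from 1) of a positive compact self-adjoint
operator `T` on a Hilbert space: `λ_k` is Lipschitz near `T` on `K_sa[H]` and
`∂_C λ_k(T) = conv{ φ⊗φ : φ ∈ E_k(T), ‖φ‖ = 1 }`, where the functional `φ⊗φ` acts on
`S ∈ K_sa[H]` by `S ↦ ⟪Sφ, φ⟫` (the trace pairing with the rank-one operator `φ⊗φ`). -/

open Filter Topology
open scoped RealInnerProductSpace

variable {E : Type*} [NormedAddCommGroup E] [NormedSpace ℝ E]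

/-- The Clarke directional derivative. -/
noncomputable def clarkeDeriv (f : E → ℝ) (x v : E) : ℝ :=
  Filter.limsup (fun p : E × ℝ => (f (p.1 + p.2 • v) - f p.1) / p.2)
    ((𝓝 x) ×ˢ (𝓝[>] (0 : ℝ)))

/-- The Clarke subdifferential. -/
def clarkeSubdiff (f : E → ℝ) (x : E) : Set (E →L[ℝ] ℝ) :=
  {ξ | ∀ v : E, ξ v ≤ clarkeDeriv f x v}

variable (H : Type*) [NormedAddCommGroup H] [InnerProductSpace ℝ H] [CompleteSpace H]

/-- The space `K_sa[H]` of compact self-adjoint operators, as a (normed) subspace of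
the bounded operators. -/
noncomputable def Ksa : Submodule ℝ (H →L[ℝ] H) where
  carrier := {S | IsSelfAdjoint S ∧ IsCompactOperator S}
  add_mem' := fun ha hb => ⟨ha.1.add hb.1, ha.2.add hb.2⟩
  zero_mem' := ⟨.zero _, isCompactOperator_zero⟩
  smul_mem' := fun c x hx => ⟨by
    rw [isSelfAdjoint_iff, star_smul, star_trivial, hx.1.star_eq], hx.2.smul c⟩

variable {H}

/-- Courant–Fischer value: the `k`-th eigenvalue from the top (for positive compact
self-adjoint operators), `λ_k(T) = sup_{dim V = k} inf_{φ ∈ V, ‖φ‖=1} ⟪Tφ,φ⟫`. -/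
noncomputable def lamK (T : H →L[ℝ] H) (k : ℕ) : ℝ :=
  sSup {r : ℝ | ∃ V : Submodule ℝ H, Module.finrank ℝ V = k ∧
    ∀ φ ∈ V, ‖φ‖ = 1 → r ≤ ⟪T φ, φ⟫}

set_option linter.unusedSectionVars false

theorem norm_sq_le_of_inner_nonneg {W : Type*} [NormedAddCommGroup W] [InnerProductSpace ℝ W]
    (A : W →L[ℝ] W) (hA : (A : W →ₗ[ℝ] W).IsSymmetric) (hnn : ∀ x, 0 ≤ ⟪A x, x⟫) (x : W) :
    ‖A x‖ ^ 2 ≤ (‖A‖ + 1) * ⟪A x, x⟫ := by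
  have hs : 0 < ‖A‖ + 1 := by positivity
  have h1 : ⟪A (A x), x⟫ = ‖A x‖ ^ 2 := by
    rw [← real_inner_self_eq_norm_sq]; exact hA (A x) x
  have h2 : ⟪A (A x), A x⟫ ≤ ‖A‖ * ‖A x‖ ^ 2 := by
    calc ⟪A (A x), A x⟫ ≤ ‖A (A x)‖ * ‖A x‖ := real_inner_le_norm _ _
      _ ≤ ‖A‖ * ‖A x‖ * ‖A x‖ := by gcongr; exact A.le_opNorm _
      _ = _ := by ring
  have h3 := hnn ((‖A‖ + 1) • x - A x)
  simp only [map_sub, map_smul, inner_sub_left, inner_sub_right, inner_smul_left,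
    inner_smul_right, h1, real_inner_self_eq_norm_sq, conj_trivial] at h3
  have h4 : (‖A‖ + 1) * ‖A x‖ ^ 2 ≤ (‖A‖ + 1) * ((‖A‖ + 1) * ⟪A x, x⟫) := by
    nlinarith [sq_nonneg ‖A x‖]
  exact le_of_mul_le_mul_left h4 hs

/-- A positive bound for the quadratic form of a compact self-adjoint operator on a closed invariant
subspace is either attained at an eigenvector or can be improved. -/
theorem exists_eigenvector_or_gap {T : H →L[ℝ] H} (hT : IsSelfAdjoint T)
    (hc : IsCompactOperator T) (W : Submodule ℝ H) [CompleteSpace W] (hW : ∀ x ∈ W, T x ∈ W)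
    {M : ℝ} (hM : 0 < M) (hle : ∀ x ∈ W, ⟪T x, x⟫ ≤ M * ‖x‖ ^ 2) :
    (∃ x ∈ W, ‖x‖ = 1 ∧ T x = M • x) ∨
      ∃ g > 0, ∀ x ∈ W, ⟪T x, x⟫ ≤ (M - g) * ‖x‖ ^ 2 := by
  let S : W →L[ℝ] W := T.restrict hW
  have hS : ∀ x : W, (S x : H) = T x := fun x => rfl
  have hSc : IsCompactOperator S := hc.restrict' (f := (T : H →ₗ[ℝ] H)) hW
  by_cases hev : Module.End.HasEigenvalue (S : W →ₗ[ℝ] W) M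
  · left
    obtain ⟨x, hx⟩ := hev.exists_hasEigenvector
    have hx0 : (x : H) ≠ 0 := by simpa using hx.2
    have hTx : T x = M • (x : H) := by
      have := congrArg (Subtype.val) hx.apply_eq_smul
      exact (hS x).symm.trans (by simpa using this)
    refine ⟨‖(x : H)‖⁻¹ • (x : H), W.smul_mem _ x.2, norm_smul_inv_norm hx0, ?_⟩
    rw [map_smul, hTx, smul_comm]
  · right
    obtain ⟨c, hc0, hcS⟩ := antilipschitzWith_iff_exists_mul_le_norm.1
      (hSc.antilipschitz_of_not_hasEigenvalue hM.ne' hev)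
    have hsym : ∀ x y : W, ⟪S x, y⟫ = ⟪x, S y⟫ := fun x y => hT.isSymmetric (x : H) y
    let A : W →L[ℝ] W := M • 1 - S
    have hA : (A : W →ₗ[ℝ] W).IsSymmetric := fun x y => by
      simp [A, inner_sub_left, inner_sub_right, inner_smul_left, inner_smul_right, hsym]
    have hAx : ∀ x : W, ⟪A x, x⟫ = M * ‖(x : H)‖ ^ 2 - ⟪T x, x⟫ := fun x => by
      simp only [A, sub_apply, smul_apply,
        one_apply_eq_self, inner_sub_left, inner_smul_left,
        real_inner_self_eq_norm_sq, conj_trivial]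
      rfl
    have hnn : ∀ x : W, 0 ≤ ⟪A x, x⟫ := fun x => by
      rw [hAx]; linarith [hle x x.2]
    refine ⟨c ^ 2 / (‖A‖ + 1), by positivity, fun x hx => ?_⟩
    have h1 := norm_sq_le_of_inner_nonneg A hA hnn ⟨x, hx⟩
    have h2 : c * ‖x‖ ≤ ‖A ⟨x, hx⟩‖ := by
      refine (hcS ⟨x, hx⟩).trans_eq ?_
      rw [← norm_neg]
      congr 1
      simp [A]
    have h3 : (c * ‖x‖) ^ 2 ≤ (‖A‖ + 1) * ⟪A ⟨x, hx⟩, ⟨x, hx⟩⟫ :=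
      (pow_le_pow_left₀ (by positivity) h2 2).trans h1
    rw [hAx] at h3
    have h4 : c ^ 2 / (‖A‖ + 1) * ‖x‖ ^ 2 ≤ M * ‖x‖ ^ 2 - ⟪T x, x⟫ := by
      rw [div_mul_eq_mul_div, div_le_iff₀ (by positivity)]
      linarith
    linarith

theorem exists_unit_mem_orthogonal {n : ℕ} {V : Submodule ℝ H} (hV : Module.finrank ℝ V = n + 1)
    (w : Fin n → H) : ∃ φ ∈ V, ‖φ‖ = 1 ∧ ∀ i, ⟪w i, φ⟫ = 0 := by
  have : FiniteDimensional ℝ V := .of_finrank_pos (by omega)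
  let f : V →ₗ[ℝ] (Fin n → ℝ) := LinearMap.pi fun i => (innerₛₗ ℝ (w i)).comp V.subtype
  have hf : LinearMap.ker f ≠ ⊥ := LinearMap.ker_ne_bot_of_finrank_lt (by simp [hV])
  obtain ⟨x, hx, hx0⟩ := Submodule.exists_mem_ne_zero_of_ne_bot hf
  have hx0' : (x : H) ≠ 0 := by simpa using hx0
  refine ⟨‖(x : H)‖⁻¹ • (x : H), V.smul_mem _ x.2, norm_smul_inv_norm hx0', fun i => ?_⟩
  have : ⟪w i, (x : H)⟫ = 0 := congrFun hx i
  rw [inner_smul_right, this, mul_zero]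

theorem abs_inner_apply_le (T : H →L[ℝ] H) (φ : H) : |⟪T φ, φ⟫| ≤ ‖T‖ * ‖φ‖ ^ 2 := by
  calc |⟪T φ, φ⟫| ≤ ‖T φ‖ * ‖φ‖ := abs_real_inner_le_norm _ _
    _ ≤ ‖T‖ * ‖φ‖ * ‖φ‖ := by gcongr; exact T.le_opNorm _
    _ = _ := by ring

theorem inner_apply_le_of_unit {T : H →L[ℝ] H} {W : Submodule ℝ H} {M : ℝ}
    (h : ∀ φ ∈ W, ‖φ‖ = 1 → ⟪T φ, φ⟫ ≤ M) {x : H} (hx : x ∈ W) : ⟪T x, x⟫ ≤ M * ‖x‖ ^ 2 := by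
  rcases eq_or_ne x 0 with rfl | hx0
  · simp
  have hn : 0 < ‖x‖ := norm_pos_iff.2 hx0
  have := h (‖x‖⁻¹ • x) (W.smul_mem _ hx) (norm_smul_inv_norm hx0)
  rw [map_smul, inner_smul_left, inner_smul_right] at this
  simp only [conj_trivial] at this
  rw [← mul_assoc, ← mul_inv, inv_mul_le_iff₀ (by positivity)] at this
  linarith [this]

theorem lamK_le {n : ℕ} (hH : ∃ V : Submodule ℝ H, Module.finrank ℝ V = n + 1) {T : H →L[ℝ] H}
    {M : ℝ} (w : Fin n → H) (h : ∀ φ, (∀ i, ⟪w i, φ⟫ = 0) → ‖φ‖ = 1 → ⟪T φ, φ⟫ ≤ M) :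
    lamK T (n + 1) ≤ M := by
  obtain ⟨V, hV⟩ := hH
  refine csSup_le ⟨-‖T‖, V, hV, fun φ _ hφ => ?_⟩ ?_
  · have := (abs_le.1 (abs_inner_apply_le T φ)).1
    simpa [hφ] using this
  · rintro r ⟨V, hV, hr⟩
    obtain ⟨φ, hφV, hφ, hw⟩ := exists_unit_mem_orthogonal hV w
    exact (hr φ hφV hφ).trans (h φ hw hφ)

theorem bddAbove_lamK {k : ℕ} (hk : 1 ≤ k) (T : H →L[ℝ] H) :
    BddAbove {r : ℝ | ∃ V : Submodule ℝ H, Module.finrank ℝ V = k ∧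
      ∀ φ ∈ V, ‖φ‖ = 1 → r ≤ ⟪T φ, φ⟫} := by
  obtain ⟨n, rfl⟩ := Nat.exists_eq_add_of_le' hk
  refine ⟨‖T‖, ?_⟩
  rintro r ⟨V, hV, hr⟩
  obtain ⟨φ, hφV, hφ, -⟩ := exists_unit_mem_orthogonal hV (fun _ => 0)
  have := (abs_le.1 (abs_inner_apply_le T φ)).2
  exact (hr φ hφV hφ).trans (by simpa [hφ] using this)

theorem le_lamK {k : ℕ} (hk : 1 ≤ k) {T : H →L[ℝ] H} {r : ℝ} {V : Submodule ℝ H}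
    (hV : Module.finrank ℝ V = k) (hr : ∀ φ ∈ V, ‖φ‖ = 1 → r ≤ ⟪T φ, φ⟫) : r ≤ lamK T k :=
  le_csSup (bddAbove_lamK hk T) ⟨V, hV, hr⟩

theorem exists_finrank_eq_of_lamK_pos {k : ℕ} {T : H →L[ℝ] H} (h : 0 < lamK T k) :
    ∃ V : Submodule ℝ H, Module.finrank ℝ V = k := by
  by_contra! hne
  have : {r : ℝ | ∃ V : Submodule ℝ H, Module.finrank ℝ V = k ∧
      ∀ φ ∈ V, ‖φ‖ = 1 → r ≤ ⟪T φ, φ⟫} = ∅ := by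
    ext r; simp [hne]
  rw [lamK, this, Real.sSup_empty] at h
  exact h.false

/-- Weyl's bound. -/
theorem lamK_le_add {k : ℕ} (hk : 1 ≤ k) (hH : ∃ V : Submodule ℝ H, Module.finrank ℝ V = k)
    (S T : H →L[ℝ] H) : lamK S k ≤ lamK T k + ‖S - T‖ := by
  obtain ⟨V, hV⟩ := hH
  refine csSup_le ⟨-‖S‖, V, hV, fun φ _ hφ => ?_⟩ ?_
  · have := (abs_le.1 (abs_inner_apply_le S φ)).1
    simpa [hφ] using this
  · rintro r ⟨V, hV, hr⟩
    refine sub_le_iff_le_add.1 (le_lamK hk hV fun φ hφV hφ => ?_)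
    have h1 := (abs_le.1 (abs_inner_apply_le (S - T) φ)).2
    have h2 := hr φ hφV hφ
    simp only [sub_apply, inner_sub_left, hφ, one_pow, mul_one] at h1
    linarith

theorem abs_lamK_sub_le {k : ℕ} (hk : 1 ≤ k) (hH : ∃ V : Submodule ℝ H, Module.finrank ℝ V = k)
    (S T : H →L[ℝ] H) : |lamK S k - lamK T k| ≤ ‖S - T‖ := by
  have h1 := lamK_le_add hk hH S T
  have h2 := lamK_le_add hk hH T S
  rw [norm_sub_rev] at h2
  exact abs_le.2 ⟨by linarith, by linarith⟩

theorem le_inner_apply_of_mem_span {ι : Type*} [Fintype ι] {T : H →L[ℝ] H} {v : ι → H} {μ : ι → ℝ}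
    (hv : Orthonormal ℝ v) (hTv : ∀ i, T (v i) = μ i • v i) {M : ℝ} (hM : ∀ i, M ≤ μ i) {x : H}
    (hx : x ∈ Submodule.span ℝ (Set.range v)) : M * ‖x‖ ^ 2 ≤ ⟪T x, x⟫ := by
  obtain ⟨c, rfl⟩ := (Submodule.mem_span_range_iff_exists_fun ℝ).1 hx
  have h1 : T (∑ i, c i • v i) = ∑ i, (μ i * c i) • v i := by
    simp only [map_sum, map_smul, hTv, smul_smul, mul_comm]
  rw [h1, hv.inner_sum, ← real_inner_self_eq_norm_sq, hv.inner_sum, Finset.mul_sum]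
  refine Finset.sum_le_sum fun i _ => ?_
  simp only [conj_trivial]
  nlinarith [mul_le_mul_of_nonneg_right (hM i) (mul_self_nonneg (c i))]

theorem mem_orthogonal_span_range {ι : Type*} {v : ι → H} {x : H} :
    x ∈ (Submodule.span ℝ (Set.range v))ᗮ ↔ ∀ i, ⟪v i, x⟫ = 0 := by
  rw [Submodule.mem_orthogonal]
  refine ⟨fun h i => h _ (Submodule.subset_span ⟨i, rfl⟩), fun h u hu => ?_⟩
  induction hu using Submodule.span_induction with
  | mem y hy => obtain ⟨i, rfl⟩ := hy; exact h i
  | zero => exact inner_zero_left _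
  | add y z _ _ hy hz => rw [inner_add_left, hy, hz, add_zero]
  | smul a y _ hy => rw [inner_smul_left, hy, mul_zero]

theorem apply_mem_orthogonal_span {ι : Type*} {T : H →L[ℝ] H} (hT : IsSelfAdjoint T) {v : ι → H}
    {μ : ι → ℝ} (hTv : ∀ i, T (v i) = μ i • v i) {x : H}
    (hx : x ∈ (Submodule.span ℝ (Set.range v))ᗮ) :
    T x ∈ (Submodule.span ℝ (Set.range v))ᗮ := by
  rw [mem_orthogonal_span_range] at hx ⊢
  intro i
  have : ⟪T (v i), x⟫ = ⟪v i, T x⟫ := hT.isSymmetric _ _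
  rw [← this, hTv, inner_smul_left, hx, mul_zero]

theorem exists_next_eigenvector {T : H →L[ℝ] H} (hT : IsSelfAdjoint T) (hc : IsCompactOperator T)
    {n : ℕ} (hpos : 0 < lamK T (n + 1)) {j : ℕ} (hj : j ≤ n) {u : Fin j → H} {μ : Fin j → ℝ}
    (hTu : ∀ i, T (u i) = μ i • u i) :
    ∃ (e : H) (M : ℝ), ‖e‖ = 1 ∧ (∀ i, ⟪u i, e⟫ = 0) ∧ T e = M • e ∧ lamK T (n + 1) ≤ M ∧
      ∀ x, (∀ i, ⟪u i, x⟫ = 0) → ⟪T x, x⟫ ≤ M * ‖x‖ ^ 2 := by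
  have hH := exists_finrank_eq_of_lamK_pos hpos
  let w : Fin n → H := fun i => if h : (i : ℕ) < j then u ⟨i, h⟩ else 0
  have hw : ∀ x, (∀ i, ⟪w i, x⟫ = 0) → ∀ i, ⟪u i, x⟫ = 0 := fun x hx i => by
    simpa [w] using hx ⟨i, i.2.trans_le hj⟩
  let W := (Submodule.span ℝ (Set.range u))ᗮ
  let s : Set ℝ := {r | ∃ x ∈ W, ‖x‖ = 1 ∧ ⟪T x, x⟫ = r}
  have hbdd : BddAbove s := by
    refine ⟨‖T‖, ?_⟩
    rintro r ⟨x, -, hx, rfl⟩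
    simpa [hx] using (abs_le.1 (abs_inner_apply_le T x)).2
  have hne : s.Nonempty := by
    obtain ⟨V, hV⟩ := hH
    obtain ⟨x, -, hx, hwx⟩ := exists_unit_mem_orthogonal hV w
    exact ⟨_, x, mem_orthogonal_span_range.2 (hw x hwx), hx, rfl⟩
  have hle : ∀ x ∈ W, ‖x‖ = 1 → ⟪T x, x⟫ ≤ sSup s := fun x hx hx1 =>
    le_csSup hbdd ⟨x, hx, hx1, rfl⟩
  have hlam : lamK T (n + 1) ≤ sSup s :=
    lamK_le hH w fun φ hφ hφ1 => hle φ (mem_orthogonal_span_range.2 (hw φ hφ)) hφ1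
  rcases exists_eigenvector_or_gap hT hc W (fun x hx => apply_mem_orthogonal_span hT hTu hx)
    (hpos.trans_le hlam) (fun x hx => inner_apply_le_of_unit hle hx) with
    ⟨e, he, he1, hTe⟩ | ⟨g, hg, hgap⟩
  · exact ⟨e, _, he1, mem_orthogonal_span_range.1 he, hTe, hlam, fun x hx =>
      inner_apply_le_of_unit hle (mem_orthogonal_span_range.2 hx)⟩
  · have : sSup s ≤ sSup s - g := by
      refine csSup_le hne ?_
      rintro r ⟨x, hx, hx1, rfl⟩
      simpa [hx1] using hgap x hx
    linarith

theorem orthonormal_cons {n : ℕ} {u : Fin n → H} (hu : Orthonormal ℝ u) {e : H} (he : ‖e‖ = 1)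
    (hue : ∀ i, ⟪u i, e⟫ = 0) : Orthonormal ℝ (Fin.cons e u : Fin (n + 1) → H) := by
  refine ⟨fun i => ?_, fun i l hil => ?_⟩
  · refine Fin.cases ?_ (fun i => ?_) i
    · simpa using he
    · simpa using hu.1 i
  · induction i using Fin.cases with
    | zero =>
      induction l using Fin.cases with
      | zero => exact absurd rfl hil
      | succ l => simpa [real_inner_comm] using hue l
    | succ i =>
      induction l using Fin.cases with
      | zero => simpa using hue i
      | succ l => simpa using hu.2 (fun h => hil (congrArg Fin.succ h))

theorem exists_orthonormal_eigenvectors {T : H →L[ℝ] H} (hT : IsSelfAdjoint T)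
    (hc : IsCompactOperator T) {n : ℕ} (hpos : 0 < lamK T (n + 1)) {j : ℕ} (hj : j ≤ n) :
    ∃ (u : Fin j → H) (μ : Fin j → ℝ), Orthonormal ℝ u ∧ (∀ i, T (u i) = μ i • u i) ∧
      ∀ i x, (∀ l, ⟪u l, x⟫ = 0) → ⟪T x, x⟫ ≤ μ i * ‖x‖ ^ 2 := by
  induction j with
  | zero => exact ⟨fun i => i.elim0, fun i => i.elim0, ⟨fun i => i.elim0, fun i => i.elim0⟩,
      fun i => i.elim0, fun i => i.elim0⟩
  | succ j ih =>
    obtain ⟨u, μ, hu, hTu, hle⟩ := ih (by omega)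
    obtain ⟨e, M, he, hue, hTe, -, hMle⟩ :=
      exists_next_eigenvector hT hc hpos (by omega : j ≤ n) hTu
    refine ⟨Fin.cons e u, Fin.cons M μ, orthonormal_cons hu he hue, fun i => ?_,
      fun i x hx => ?_⟩
    · refine Fin.cases ?_ (fun i => ?_) i
      · simpa using hTe
      · simpa using hTu i
    · have hx' : ∀ l, ⟪u l, x⟫ = 0 := fun l => by simpa using hx l.succ
      refine Fin.cases ?_ (fun i => ?_) i
      · simpa using hMle x hx'
      · simpa using hle i x hx'

/-- `v 0` is a normalized eigenvector for the `(n + 1)`-st eigenvalue `l`, and the remaining `v i`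
are orthonormal eigenvectors for the `n` eigenvalues above it. -/
structure IsTopEigensystem (T : H →L[ℝ] H) {n : ℕ} (v : Fin (n + 1) → H) (μ : Fin (n + 1) → ℝ)
    (l : ℝ) : Prop where
  orthonormal : Orthonormal ℝ v
  apply_eq : ∀ i, T (v i) = μ i • v i
  zero_eq : μ 0 = l
  le : ∀ i, l ≤ μ i
  inner_le : ∀ x, (∀ i : Fin n, ⟪v i.succ, x⟫ = 0) → ⟪T x, x⟫ ≤ l * ‖x‖ ^ 2

theorem exists_isTopEigensystem {T : H →L[ℝ] H} (hT : IsSelfAdjoint T) (hc : IsCompactOperator T)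
    {n : ℕ} (hpos : 0 < lamK T (n + 1)) :
    ∃ (v : Fin (n + 1) → H) (μ : Fin (n + 1) → ℝ), IsTopEigensystem T v μ (lamK T (n + 1)) := by
  obtain ⟨u, μ, hu, hTu, hle⟩ := exists_orthonormal_eigenvectors hT hc hpos le_rfl
  obtain ⟨e, M, he, hue, hTe, hM, hMle⟩ := exists_next_eigenvector hT hc hpos le_rfl hTu
  have hv := orthonormal_cons hu he hue
  have hMμ : ∀ i, M ≤ μ i := fun i => by
    simpa [hTe, inner_smul_left, he] using hle i e hue
  have hTv : ∀ i, T ((Fin.cons e u : Fin (n + 1) → H) i) =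
      (Fin.cons M μ : Fin (n + 1) → ℝ) i • (Fin.cons e u : Fin (n + 1) → H) i := fun i => by
    refine Fin.cases ?_ (fun i => ?_) i
    · simpa using hTe
    · simpa using hTu i
  have hMv : ∀ i, M ≤ (Fin.cons M μ : Fin (n + 1) → ℝ) i := fun i => by
    refine Fin.cases ?_ (fun i => ?_) i
    · simp
    · simpa using hMμ i
  have hMe : M = lamK T (n + 1) := by
    refine le_antisymm (le_lamK (by omega)
      (V := Submodule.span ℝ (Set.range (Fin.cons e u : Fin (n + 1) → H))) ?_ ?_) hM
    · simpa using finrank_span_eq_card hv.linearIndependent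
    · intro φ hφ hφ1
      simpa [hφ1] using le_inner_apply_of_mem_span hv hTv hMv hφ
  rw [← hMe]
  exact ⟨_, _, hv, hTv, rfl, hMv, fun x hx => hMle x fun i => by simpa using hx i⟩

/-- A Davis–Kahan type estimate: spectral subspaces of nearby operators for separated parts of the
spectrum are almost orthogonal. -/
theorem norm_starProjection_le_of_gap {ι : Type*} [Fintype ι] {A B : H →L[ℝ] H}
    (hB : IsSelfAdjoint B) {F : Submodule ℝ H} [F.HasOrthogonalProjection]
    (hF : ∀ x ∈ F, B x ∈ F) {β g : ℝ} (hg : 0 < g) (hβ : ∀ x ∈ F, ⟪B x, x⟫ ≤ β * ‖x‖ ^ 2)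
    {v : ι → H} {μ : ι → ℝ} (hv : Orthonormal ℝ v) (hAv : ∀ i, A (v i) = μ i • v i)
    (hμ : ∀ i, β + g ≤ μ i) {x : H} (hx : x ∈ Submodule.span ℝ (Set.range v)) :
    g * ‖F.starProjection x‖ ≤ Fintype.card ι * (‖A - B‖ * ‖x‖) := by
  have key : ∀ i, g * ‖F.starProjection (v i)‖ ≤ ‖A - B‖ := fun i => by
    set y := F.starProjection (v i) with hy
    have hyF : y ∈ F := F.starProjection_apply_mem (v i)
    have hvy : ∀ z ∈ F, ⟪v i, z⟫ = ⟪y, z⟫ := fun z hz => by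
      rw [hy, F.inner_starProjection_left_eq_right, F.starProjection_eq_self_iff.2 hz]
    have h1 : ⟪A (v i), y⟫ = μ i * ‖y‖ ^ 2 := by
      rw [hAv, inner_smul_left, hvy y hyF, real_inner_self_eq_norm_sq, conj_trivial]
    have h2 : ⟪B (v i), y⟫ = ⟪B y, y⟫ := by
      have e1 : ⟪B (v i), y⟫ = ⟪v i, B y⟫ := hB.isSymmetric _ _
      have e2 : ⟪B y, y⟫ = ⟪y, B y⟫ := hB.isSymmetric _ _
      rw [e1, e2, hvy _ (hF y hyF)]
    have h3 : ⟪(A - B) (v i), y⟫ ≤ ‖A - B‖ * ‖y‖ := by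
      calc ⟪(A - B) (v i), y⟫ ≤ ‖(A - B) (v i)‖ * ‖y‖ := real_inner_le_norm _ _
        _ ≤ ‖A - B‖ * ‖v i‖ * ‖y‖ := by gcongr; exact (A - B).le_opNorm _
        _ = _ := by rw [hv.1 i, mul_one]
    rw [sub_apply, inner_sub_left, h1, h2] at h3
    have h4 := hβ y hyF
    have h5 : g * ‖y‖ * ‖y‖ ≤ ‖A - B‖ * ‖y‖ := by
      nlinarith [mul_le_mul_of_nonneg_right (hμ i) (sq_nonneg ‖y‖)]
    rcases (norm_nonneg y).eq_or_lt with h0 | h0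
    · rw [← h0, mul_zero]; positivity
    · exact le_of_mul_le_mul_right h5 h0
  obtain ⟨c, rfl⟩ := (Submodule.mem_span_range_iff_exists_fun ℝ).1 hx
  set x := ∑ i, c i • v i with hxdef
  have hci : ∀ i, |c i| ≤ ‖x‖ := fun i => by
    rw [← hv.inner_right_fintype c i]
    simpa [hv.1 i] using abs_real_inner_le_norm (v i) x
  calc g * ‖F.starProjection x‖ = g * ‖∑ i, c i • F.starProjection (v i)‖ := by
        simp only [hxdef, map_sum, map_smul]
    _ ≤ g * ∑ i, |c i| * ‖F.starProjection (v i)‖ := by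
        gcongr
        refine (norm_sum_le _ _).trans_eq ?_
        simp [norm_smul]
    _ = ∑ i, |c i| * (g * ‖F.starProjection (v i)‖) := by
        rw [Finset.mul_sum]
        exact Finset.sum_congr rfl fun i _ => by ring
    _ ≤ ∑ _i : ι, ‖x‖ * ‖A - B‖ := by
        gcongr with i
        · exact hci i
        · exact key i
    _ = _ := by
        rw [Finset.sum_const, Finset.card_univ, nsmul_eq_mul, mul_comm ‖x‖]

/-- A normalized eigenvector for the `(n + 1)`-st eigenvalue can be completed to a top
eigensystem. -/
theorem IsTopEigensystem.exists_zero_eq {T : H →L[ℝ] H} (hT : IsSelfAdjoint T) {n : ℕ}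
    {v : Fin (n + 1) → H} {μ : Fin (n + 1) → ℝ} {l : ℝ} (h : IsTopEigensystem T v μ l) {φ : H}
    (hφ : ‖φ‖ = 1) (hTφ : T φ = l • φ) :
    ∃ u : Fin (n + 1) → H, IsTopEigensystem T u μ l ∧ u 0 = φ := by
  let ρ := (Submodule.span ℝ {v 0 - φ})ᗮ.reflection
  have hTy : T (v 0 - φ) = l • (v 0 - φ) := by
    rw [map_sub, h.apply_eq, h.zero_eq, hTφ, smul_sub]
  have hcomm : ∀ x, T (ρ x) = ρ (T x) := fun x => by
    have h1 : ⟪v 0 - φ, T x⟫ = l * ⟪v 0 - φ, x⟫ := by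
      have : ⟪T (v 0 - φ), x⟫ = ⟪v 0 - φ, T x⟫ := hT.isSymmetric _ _
      rw [← this, hTy, inner_smul_left, conj_trivial]
    simp only [ρ, Submodule.reflection_orthogonal_apply, Submodule.reflection_singleton_apply, h1,
      map_neg, map_sub T (2 • _), map_nsmul, map_smul, hTy]
    module
  have hρρ : ∀ x, ρ (ρ x) = x := Submodule.reflection_reflection _
  refine ⟨fun i => ρ (v i), ⟨?_, fun i => ?_, h.zero_eq, h.le, fun x hx => ?_⟩, ?_⟩
  · exact h.orthonormal.comp_linearIsometryEquiv ρ
  · rw [hcomm, h.apply_eq, map_smul]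
  · have := h.inner_le (ρ x) fun i => by
      rw [← ρ.inner_map_map, hρρ]; exact hx i
    rwa [hcomm, ρ.inner_map_map, ρ.norm_map] at this
  · exact Submodule.reflection_sub (by rw [h.orthonormal.1, hφ])

theorem isCompactOperator_starProjection (K : Submodule ℝ H) [FiniteDimensional ℝ K] :
    IsCompactOperator K.starProjection :=
  (isCompactOperator_of_locallyCompactSpace_rng K.subtypeL).comp_clm K.orthogonalProjectionOnto

/-- Near the operators `T + ε P` with suitable `P`, the function `lamK` has directional derivatives
bounded below by those of the quadratic form at `φ`. -/
theorem exists_lamK_perturbation {T : H →L[ℝ] H} (hT : IsSelfAdjoint T)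
    (hc : IsCompactOperator T) {n : ℕ} (hpos : 0 < lamK T (n + 1)) {φ : H} (hφ : ‖φ‖ = 1)
    (hTφ : T φ = lamK T (n + 1) • φ) :
    ∃ P : H →L[ℝ] H, IsSelfAdjoint P ∧ IsCompactOperator P ∧ ∀ (S : H →L[ℝ] H) (ε : ℝ), 0 < ε →
      ∃ C : ℝ, ∀ᶠ t in 𝓝[>] (0 : ℝ), t * ⟪S φ, φ⟫ - C * t ^ 2 ≤
        lamK (T + ε • P + t • S) (n + 1) - lamK (T + ε • P) (n + 1) := by
  have hH := exists_finrank_eq_of_lamK_pos hpos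
  obtain ⟨v, μ, hv⟩ := exists_isTopEigensystem hT hc hpos
  obtain ⟨u, hu, rfl⟩ := hv.exists_zero_eq hT hφ hTφ
  set l := lamK T (n + 1)
  let V := Submodule.span ℝ (Set.range fun i : Fin n => u i.succ)
  have : FiniteDimensional ℝ V := FiniteDimensional.span_of_finite ℝ (Set.finite_range _)
  have hPV : ∀ w ∈ V, V.starProjection w = w := fun w hw => V.starProjection_eq_self_iff.2 hw
  have hPo : ∀ w ∈ Vᗮ, V.starProjection w = 0 := fun w hw =>
    V.starProjection_apply_eq_zero_iff.2 hw
  refine ⟨V.starProjection, isSelfAdjoint_starProjection V, isCompactOperator_starProjection V,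
    fun S ε hε => ⟨2 * ‖S‖ ^ 2 / ε, ?_⟩⟩
  have hsmall : ∀ᶠ t in 𝓝[>] (0 : ℝ), t < ε / (4 * (‖S‖ + 1)) :=
    nhdsWithin_le_nhds (gt_mem_nhds (by positivity))
  filter_upwards [hsmall, self_mem_nhdsWithin] with t ht ht0
  have ht0 : 0 < t := ht0
  have hup : lamK (T + ε • V.starProjection) (n + 1) ≤ l := by
    refine lamK_le hH (fun i : Fin n => u i.succ) fun x hx hx1 => ?_
    have h1 := hu.inner_le x hx
    simpa [hPo x (mem_orthogonal_span_range.2 hx), hx1] using h1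
  refine le_sub_iff_add_le.2 ((add_le_add le_rfl hup).trans (le_lamK (by omega)
    (V := Submodule.span ℝ (Set.range u)) ?_ fun x hx hx1 => ?_))
  · simpa using finrank_span_eq_card hu.orthonormal.linearIndependent
  have hTx := le_inner_apply_of_mem_span hu.orthonormal hu.apply_eq hu.le hx
  obtain ⟨c, rfl⟩ := (Submodule.mem_span_range_iff_exists_fun ℝ).1 hx
  rw [Fin.sum_univ_succ] at hTx hx1 ⊢
  set a := c 0
  set w := ∑ i : Fin n, c i.succ • u i.succ with hw
  have hwV : w ∈ V := Submodule.sum_mem _ fun i _ =>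
    V.smul_mem _ (Submodule.subset_span ⟨i, rfl⟩)
  have hu0V : u 0 ∈ Vᗮ := mem_orthogonal_span_range.2 fun i =>
    hu.orthonormal.2 (Fin.succ_ne_zero i)
  have hw0 : ⟪w, u 0⟫ = 0 := (Submodule.mem_orthogonal _ _).1 hu0V w hwV
  have hw0' : ⟪u 0, w⟫ = 0 := by rw [real_inner_comm]; exact hw0
  have hnorm : a ^ 2 + ‖w‖ ^ 2 = 1 := by
    have : ‖a • u 0 + w‖ ^ 2 = 1 := by rw [hx1, one_pow]
    rw [← real_inner_self_eq_norm_sq] at this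
    simp only [inner_add_left, inner_add_right, inner_smul_left, inner_smul_right, hw0, hw0',
      real_inner_self_eq_norm_sq, hφ, conj_trivial] at this
    linarith
  have hP : ⟪V.starProjection (a • u 0 + w), a • u 0 + w⟫ = ‖w‖ ^ 2 := by
    rw [map_add, map_smul, hPo _ hu0V, hPV _ hwV, smul_zero, zero_add, inner_add_right,
      inner_smul_right, hw0, mul_zero, zero_add, real_inner_self_eq_norm_sq]
  have ha : |a| ≤ 1 := abs_le_one_iff_mul_self_le_one.2 (by nlinarith [sq_nonneg ‖w‖])
  have hq : ⟪S (u 0), u 0⟫ ≤ ‖S‖ := by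
    simpa [hφ] using (abs_le.1 (abs_inner_apply_le S (u 0))).2
  have hSw : -(‖S‖ * ‖w‖ ^ 2) ≤ ⟪S w, w⟫ := (abs_le.1 (abs_inner_apply_le S w)).1
  have hc1 : |a * ⟪S (u 0), w⟫| ≤ ‖S‖ * ‖w‖ := by
    rw [abs_mul]
    calc |a| * |⟪S (u 0), w⟫| ≤ 1 * (‖S (u 0)‖ * ‖w‖) := by
          gcongr; exact abs_real_inner_le_norm _ _
      _ ≤ 1 * (‖S‖ * ‖u 0‖ * ‖w‖) := by gcongr; exact S.le_opNorm _
      _ = _ := by rw [hφ]; ring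
  have hc2 : |a * ⟪S w, u 0⟫| ≤ ‖S‖ * ‖w‖ := by
    rw [abs_mul]
    calc |a| * |⟪S w, u 0⟫| ≤ 1 * (‖S w‖ * ‖u 0‖) := by
          gcongr; exact abs_real_inner_le_norm _ _
      _ ≤ 1 * (‖S‖ * ‖w‖ * ‖u 0‖) := by gcongr; exact S.le_opNorm _
      _ = _ := by rw [hφ]; ring
  have hS : ⟪S (u 0), u 0⟫ - 2 * ‖S‖ * ‖w‖ ^ 2 - 2 * ‖S‖ * ‖w‖ ≤
      ⟪S (a • u 0 + w), a • u 0 + w⟫ := by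
    have e : ⟪S (a • u 0 + w), a • u 0 + w⟫ = a ^ 2 * ⟪S (u 0), u 0⟫ + a * ⟪S (u 0), w⟫ +
        a * ⟪S w, u 0⟫ + ⟪S w, w⟫ := by
      simp only [map_add, map_smul, inner_add_left, inner_add_right, inner_smul_left,
        inner_smul_right, conj_trivial]
      ring
    rw [e]
    have h1 := (abs_le.1 hc1).1
    have h2 := (abs_le.1 hc2).1
    have h3 : a ^ 2 = 1 - ‖w‖ ^ 2 := by linarith
    rw [h3]
    nlinarith [mul_le_mul_of_nonneg_right hq (sq_nonneg ‖w‖)]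
  have hfinal : -(2 * ‖S‖ ^ 2 / ε * t ^ 2) ≤
      ε * ‖w‖ ^ 2 - t * (2 * ‖S‖ * ‖w‖ ^ 2 + 2 * ‖S‖ * ‖w‖) := by
    have h1 : 0 ≤ ε / 2 * (‖w‖ - 2 * t * ‖S‖ / ε) ^ 2 := by positivity
    have h2 : ε / 2 * (‖w‖ - 2 * t * ‖S‖ / ε) ^ 2 =
        ε / 2 * ‖w‖ ^ 2 - 2 * t * ‖S‖ * ‖w‖ + 2 * ‖S‖ ^ 2 / ε * t ^ 2 := by
      field_simp
      ring
    have h3 : 2 * (t * ‖S‖) ≤ ε / 2 := by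
      rw [lt_div_iff₀ (by positivity)] at ht
      nlinarith [norm_nonneg S]
    nlinarith [mul_le_mul_of_nonneg_right h3 (sq_nonneg ‖w‖)]
  simp only [add_apply, smul_apply, inner_add_left _ _ (a • u 0 + w)]
  simp only [inner_smul_left, hP, conj_trivial]
  rw [hx1] at hTx
  nlinarith [mul_le_mul_of_nonneg_left hS ht0.le]

/-- For `X`, `Y` near `T`, there is a common test vector for upper bounding the difference of their
`(n + 1)`-st eigenvalues that is close to the corresponding eigenspace of `T`. -/
theorem exists_near_eigenspace {T : H →L[ℝ] H} (hT : IsSelfAdjoint T) (hc : IsCompactOperator T)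
    {n : ℕ} (hpos : 0 < lamK T (n + 1)) {δ : ℝ} (hδ : 0 < δ) :
    ∃ r > 0, ∀ X Y : H →L[ℝ] H, IsSelfAdjoint X → IsCompactOperator X → IsSelfAdjoint Y →
      IsCompactOperator Y → ‖T - X‖ ≤ r → ‖Y - T‖ ≤ r →
      ∃ φ b : H, ‖φ‖ = 1 ∧ lamK Y (n + 1) ≤ ⟪Y φ, φ⟫ ∧ ⟪X φ, φ⟫ ≤ lamK X (n + 1) ∧
        T b = lamK T (n + 1) • b ∧ ‖φ - b‖ ≤ δ := by
  have hH := exists_finrank_eq_of_lamK_pos hpos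
  obtain ⟨v, μ, hv⟩ := exists_isTopEigensystem hT hc hpos
  set l := lamK T (n + 1)
  let E₀ := Module.End.eigenspace (T : H →ₗ[ℝ] H) l
  have hE : ∀ x, x ∈ E₀ ↔ T x = l • x := fun x => Module.End.mem_eigenspace_iff
  have : FiniteDimensional ℝ E₀ := ContinuousLinearMap.finite_dimensional_eigenspace hc l hpos.ne'
  let ι := {i : Fin (n + 1) // l < μ i}
  let p : ι → H := fun i => v i
  have hp : Orthonormal ℝ p := hv.orthonormal.comp _ Subtype.val_injective
  have hTp : ∀ i, T (p i) = μ i • p i := fun i => hv.apply_eq i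
  let U := Submodule.span ℝ (Set.range p)
  have : FiniteDimensional ℝ U := FiniteDimensional.span_of_finite ℝ (Set.finite_range _)
  let F := (E₀ ⊔ U)ᗮ
  have hF : ∀ x, x ∈ F ↔ x ∈ E₀ᗮ ∧ x ∈ Uᗮ := fun x => by
    rw [← Submodule.mem_inf, Submodule.inf_orthogonal]
  have hFinv : ∀ x ∈ F, T x ∈ F := fun x hx => by
    rw [hF] at hx ⊢
    refine ⟨(Submodule.mem_orthogonal _ _).2 fun e he => ?_,
      apply_mem_orthogonal_span hT hTp hx.2⟩
    have : ⟪T e, x⟫ = ⟪e, T x⟫ := hT.isSymmetric _ _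
    rw [← this, (hE e).1 he, inner_smul_left, (Submodule.mem_orthogonal _ _).1 hx.1 e he, mul_zero]
  have hFle : ∀ x ∈ F, ⟪T x, x⟫ ≤ l * ‖x‖ ^ 2 := fun x hx => by
    refine hv.inner_le x fun i => ?_
    rw [hF] at hx
    rcases (hv.le i.succ).eq_or_lt with h | h
    · exact (Submodule.mem_orthogonal _ _).1 hx.1 _ ((hE _).2 (by rw [hv.apply_eq, ← h]))
    · exact mem_orthogonal_span_range.1 hx.2 ⟨i.succ, h⟩
  obtain ⟨g₁, hg₁, hgap⟩ : ∃ g > 0, ∀ x ∈ F, ⟪T x, x⟫ ≤ (l - g) * ‖x‖ ^ 2 := by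
    refine (exists_eigenvector_or_gap hT hc F hFinv hpos hFle).resolve_left ?_
    rintro ⟨x, hx, hx1, hTx⟩
    have := (Submodule.mem_orthogonal _ _).1 ((hF x).1 hx).1 x ((hE x).2 hTx)
    rw [real_inner_self_eq_norm_sq, hx1] at this
    norm_num at this
  obtain ⟨g₂, hg₂, hμ⟩ : ∃ g > 0, ∀ i : ι, l + g ≤ μ i := by
    have h1 : ∀ᶠ g in 𝓝[>] (0 : ℝ), ∀ i : ι, g < μ i - l := eventually_all.2 fun i =>
      nhdsWithin_le_nhds (gt_mem_nhds (sub_pos.2 i.2))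
    obtain ⟨g, hg, hg0⟩ := (h1.and self_mem_nhdsWithin).exists
    exact ⟨g, hg0, fun i => by linarith [hg i]⟩
  set g := min g₁ g₂
  have hg : 0 < g := lt_min hg₁ hg₂
  have hgg₁ : g ≤ g₁ := min_le_left _ _
  have hgg₂ : g ≤ g₂ := min_le_right _ _
  set N : ℝ := n + 1 with hN
  have hN0 : 0 < N := by positivity
  refine ⟨min (min (g / 2) (l / 2)) (g * δ / (4 * N)), by positivity, ?_⟩
  set r := min (min (g / 2) (l / 2)) (g * δ / (4 * N))
  have hr1 : r ≤ g / 2 := (min_le_left _ _).trans (min_le_left _ _)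
  have hr2 : r ≤ l / 2 := (min_le_left _ _).trans (min_le_right _ _)
  have hr3 : N * r ≤ g * δ / 4 := by
    have : r ≤ g * δ / (4 * N) := min_le_right _ _
    rw [le_div_iff₀ (by positivity)] at this
    linarith
  intro X Y hXsa hXc hYsa hYc hX hY
  have hlX : |l - lamK X (n + 1)| ≤ r := (abs_lamK_sub_le (by omega) hH T X).trans hX
  have hlY : |lamK Y (n + 1) - l| ≤ r := (abs_lamK_sub_le (by omega) hH Y T).trans hY
  rw [abs_le] at hlX hlY
  obtain ⟨vX, μX, hvX⟩ := exists_isTopEigensystem hXsa hXc (n := n) (by linarith)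
  obtain ⟨vY, μY, hvY⟩ := exists_isTopEigensystem hYsa hYc (n := n) (by linarith)
  obtain ⟨φ, hφY, hφ, hφX⟩ := exists_unit_mem_orthogonal
    (V := Submodule.span ℝ (Set.range vY)) (n := n)
    (by simpa using finrank_span_eq_card hvY.orthonormal.linearIndependent)
    (fun i => vX i.succ)
  obtain ⟨b, hb, a, ha, hba⟩ := Submodule.mem_sup.1 ((E₀ ⊔ U).starProjection_apply_mem φ)
  refine ⟨φ, b, hφ, ?_, ?_, (hE b).1 hb, ?_⟩
  · simpa [hφ] using le_inner_apply_of_mem_span hvY.orthonormal hvY.apply_eq hvY.le hφY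
  · simpa [hφ] using hvX.inner_le φ hφX
  set c := F.starProjection φ with hcdef
  have hcF : c ∈ F := F.starProjection_apply_mem φ
  have hsum : b + a + c = φ := by
    rw [hba]; exact (E₀ ⊔ U).starProjection_add_starProjection_orthogonal φ
  have hc_le : g / 2 * ‖c‖ ≤ N * r := by
    have h1 := norm_starProjection_le_of_gap (A := Y) hT hFinv (β := l - g) (half_pos hg)
      (fun x hx => (hgap x hx).trans (by gcongr)) hvY.orthonormal hvY.apply_eq
      (fun i => by linarith [hvY.le i]) hφY
    refine h1.trans ?_
    rw [hφ, mul_one, Fintype.card_fin, Nat.cast_succ]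
    gcongr
  have ha_le : g / 2 * ‖a‖ ≤ N * r := by
    let W := (Submodule.span ℝ (Set.range fun i : Fin n => vX i.succ))ᗮ
    have hφW : φ ∈ W := mem_orthogonal_span_range.2 hφX
    have h1 := norm_starProjection_le_of_gap (A := T) (F := W) hXsa
      (fun x hx => apply_mem_orthogonal_span hXsa (fun i => hvX.apply_eq i.succ) hx)
      (β := lamK X (n + 1)) (half_pos hg)
      (fun x hx => hvX.inner_le x (mem_orthogonal_span_range.1 hx)) hp hTp
      (fun i => by linarith [hμ i]) ha
    have hab : ⟪a, b⟫ = 0 := by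
      have hbU : b ∈ Uᗮ := mem_orthogonal_span_range.2 fun i => by
        have e1 : ⟪T (p i), b⟫ = ⟪p i, T b⟫ := hT.isSymmetric _ _
        rw [hTp, (hE b).1 hb, inner_smul_left, inner_smul_right, conj_trivial] at e1
        have e2 : (μ i - l) * ⟪p i, b⟫ = 0 := by linarith
        exact (mul_eq_zero.1 e2).resolve_left (sub_pos.2 i.2).ne'
      exact (Submodule.mem_orthogonal _ _).1 hbU a ha
    have hac : ⟪a, c⟫ = 0 := (Submodule.mem_orthogonal _ _).1 ((hF c).1 hcF).2 a ha
    have h2 : ‖a‖ ^ 2 ≤ ‖W.starProjection a‖ := by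
      calc ‖a‖ ^ 2 = ⟪a, φ⟫ := by
            rw [← hsum, inner_add_right, inner_add_right, hab, hac,
              real_inner_self_eq_norm_sq, zero_add, add_zero]
        _ = ⟪W.starProjection a, φ⟫ := by
            rw [W.inner_starProjection_left_eq_right, W.starProjection_eq_self_iff.2 hφW]
        _ ≤ ‖W.starProjection a‖ * ‖φ‖ := real_inner_le_norm _ _
        _ = _ := by rw [hφ, mul_one]
    have hcard : (Fintype.card ι : ℝ) ≤ N := by
      have : Fintype.card ι ≤ n + 1 := (Fintype.card_subtype_le _).trans_eq (Fintype.card_fin _)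
      rw [hN]
      exact_mod_cast this
    have h3 : g / 2 * ‖a‖ * ‖a‖ ≤ N * r * ‖a‖ := by
      calc g / 2 * ‖a‖ * ‖a‖ = g / 2 * ‖a‖ ^ 2 := by ring
        _ ≤ g / 2 * ‖W.starProjection a‖ := by gcongr
        _ ≤ Fintype.card ι * (‖T - X‖ * ‖a‖) := h1
        _ ≤ N * (r * ‖a‖) := by gcongr
        _ = _ := by ring
    rcases (norm_nonneg a).eq_or_lt with h0 | h0
    · rw [← h0, mul_zero]
      exact mul_nonneg hN0.le ((norm_nonneg _).trans hX)
    · exact le_of_mul_le_mul_right h3 h0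
  have hle : ‖φ - b‖ ≤ ‖a‖ + ‖c‖ := by
    have : φ - b = a + c := by rw [← hsum]; abel
    rw [this]; exact norm_add_le _ _
  have : g * (‖a‖ + ‖c‖) ≤ g * δ := by linarith
  exact hle.trans (le_of_mul_le_mul_left this hg)

theorem inner_apply_le_of_near {S : H →L[ℝ] H} {φ b : H} {h δ : ℝ} (hφ : ‖φ‖ = 1)
    (hb : ⟪S b, b⟫ ≤ h * ‖b‖ ^ 2) (hδ : ‖φ - b‖ ≤ δ) (hδ1 : δ ≤ 1) :
    ⟪S φ, φ⟫ ≤ h + 3 * (‖S‖ + |h|) * δ := by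
  have hδ0 : 0 ≤ δ := (norm_nonneg _).trans hδ
  have hb1 : ‖b‖ ≤ 1 + δ := by
    have := norm_sub_norm_le b φ
    rw [norm_sub_rev] at this
    linarith
  have hb2 : 1 - δ ≤ ‖b‖ := by
    have := norm_sub_norm_le φ b
    linarith
  have e : ⟪S φ, φ⟫ = ⟪S b, b⟫ + ⟪S (φ - b), φ⟫ + ⟪S b, φ - b⟫ := by
    simp only [map_sub, inner_sub_left, inner_sub_right]; ring
  have h1 : ⟪S (φ - b), φ⟫ ≤ ‖S‖ * δ := by
    calc ⟪S (φ - b), φ⟫ ≤ ‖S (φ - b)‖ * ‖φ‖ := real_inner_le_norm _ _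
      _ ≤ ‖S‖ * ‖φ - b‖ * ‖φ‖ := by gcongr; exact S.le_opNorm _
      _ ≤ ‖S‖ * δ * 1 := by rw [hφ]; gcongr
      _ = _ := mul_one _
  have h2 : ⟪S b, φ - b⟫ ≤ ‖S‖ * 2 * δ := by
    calc ⟪S b, φ - b⟫ ≤ ‖S b‖ * ‖φ - b‖ := real_inner_le_norm _ _
      _ ≤ ‖S‖ * ‖b‖ * ‖φ - b‖ := by gcongr; exact S.le_opNorm _
      _ ≤ ‖S‖ * 2 * δ := by gcongr; linarith
  have h3 : h * ‖b‖ ^ 2 - h ≤ |h| * (3 * δ) := by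
    calc h * ‖b‖ ^ 2 - h ≤ |h * (‖b‖ ^ 2 - 1)| := by rw [mul_sub, mul_one]; exact le_abs_self _
      _ = |h| * |‖b‖ ^ 2 - 1| := abs_mul _ _
      _ ≤ |h| * (3 * δ) := by
        gcongr
        exact abs_le.2 ⟨by nlinarith [norm_nonneg b], by nlinarith [norm_nonneg b]⟩
  linarith

/-- The convex hull of a compact set with finite-dimensional linear span is compact. -/
theorem isCompact_convexHull_of_finiteDimensional_span {F : Type*} [AddCommGroup F] [Module ℝ F]
    [TopologicalSpace F] [IsTopologicalAddGroup F] [ContinuousSMul ℝ F] {K : Set F}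
    (hK : IsCompact K) [FiniteDimensional ℝ (Submodule.span ℝ K)] :
    IsCompact (convexHull ℝ K) := by
  set N := Module.finrank ℝ (Submodule.span ℝ K) + 1 with hN
  have himage : convexHull ℝ K = (fun p : (Fin N → ℝ) × (Fin N → F) => ∑ i, p.1 i • p.2 i) ''
      (stdSimplex ℝ (Fin N) ×ˢ Set.univ.pi fun _ => K) := by
    refine Set.Subset.antisymm (fun x hx => ?_) ?_
    · obtain ⟨x₀, hx₀⟩ := convexHull_nonempty_iff.1 ⟨x, hx⟩
      obtain ⟨ι, _, z, w, hz, hind, hw, hw1, hsum⟩ := eq_pos_convex_span_of_mem_convexHull hx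
      have hcard : Fintype.card ι ≤ Fintype.card (Fin N) := by
        rw [Fintype.card_fin]
        refine hind.card_le_finrank_succ.trans (Nat.succ_le_succ (Submodule.finrank_mono ?_))
        refine (vectorSpan_mono ℝ hz).trans ?_
        rw [vectorSpan, Submodule.span_le]
        rintro _ ⟨a, ha, b, hb, rfl⟩
        exact Submodule.sub_mem _ (Submodule.subset_span ha) (Submodule.subset_span hb)
      obtain ⟨e⟩ := Function.Embedding.nonempty_of_card_le hcard
      have hz' (i : ι) : Function.extend e z (fun _ => x₀) (e i) = z i :=
        e.injective.extend_apply _ _ _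
      have hw' (i : ι) : Function.extend e w 0 (e i) = w i := e.injective.extend_apply _ _ _
      have hw0 (j : Fin N) (hj : j ∉ Set.range e) : Function.extend e w 0 j = 0 :=
        Function.extend_apply' _ _ _ hj
      refine ⟨(Function.extend e w 0, Function.extend e z fun _ => x₀), ⟨⟨fun j => ?_, ?_⟩,
        fun j _ => ?_⟩, ?_⟩
      · by_cases hj : j ∈ Set.range e
        · obtain ⟨i, rfl⟩ := hj
          exact (hw i).le.trans_eq (hw' i).symm
        · exact (hw0 j hj).ge
      · rw [← hw1]
        exact (Fintype.sum_of_injective e e.injective _ _ hw0 fun i => (hw' i).symm).symm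
      · by_cases hj : j ∈ Set.range e
        · obtain ⟨i, rfl⟩ := hj
          simpa only [hz'] using hz (Set.mem_range_self i)
        · simpa only [Function.extend_apply' z (fun _ => x₀) j hj] using hx₀
      · rw [← hsum]
        refine (Fintype.sum_of_injective e e.injective _ _ (fun j hj => ?_) fun i => ?_).symm
        · simp only [hw0 j hj, zero_smul]
        · simp only [hz', hw']
    · rintro _ ⟨⟨w, z⟩, ⟨hw, hz⟩, rfl⟩
      exact (convex_convexHull ℝ K).sum_mem (fun i _ => hw.1 i) hw.2
        fun i _ => subset_convexHull ℝ K (hz i trivial)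
  rw [himage]
  refine ((isCompact_stdSimplex ℝ (Fin N)).prod (isCompact_univ_pi fun _ => hK)).image ?_
  fun_prop

/-- A functional outside the convex hull of a compact set of functionals with finite-dimensional
span is strictly separated from it by evaluation at a vector. -/
theorem exists_forall_apply_le_lt_apply {K : Set (E →L[ℝ] ℝ)} (hK : IsCompact K)
    [FiniteDimensional ℝ (Submodule.span ℝ K)] {ξ : E →L[ℝ] ℝ} (hξ : ξ ∉ convexHull ℝ K) :
    ∃ (v : E) (u : ℝ), (∀ ζ ∈ K, ζ v ≤ u) ∧ u < ξ v := by
  have : LocallyConvexSpace ℝ (WeakDual ℝ E) :=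
    inferInstanceAs (LocallyConvexSpace ℝ (WeakBilin (topDualPairing ℝ E)))
  let e : (E →L[ℝ] ℝ) ≃ₗ[ℝ] WeakDual ℝ E := StrongDual.toWeakDual
  have heK : IsCompact (e '' K) := hK.image NormedSpace.Dual.toWeakDual_continuous
  have hspan : FiniteDimensional ℝ (Submodule.span ℝ (e '' K)) := by
    have := Submodule.map_span (e : (E →L[ℝ] ℝ) →ₗ[ℝ] WeakDual ℝ E) K
    rw [LinearEquiv.coe_coe] at this
    rw [← this]
    infer_instance
  have heξ : e ξ ∉ convexHull ℝ (e '' K) := by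
    have := (e : (E →L[ℝ] ℝ) →ₗ[ℝ] WeakDual ℝ E).image_convexHull K
    rw [LinearEquiv.coe_coe] at this
    rwa [← this, e.injective.mem_set_image]
  obtain ⟨f, u, hf, hu⟩ := geometric_hahn_banach_closed_point (convex_convexHull ℝ (e '' K))
    (isCompact_convexHull_of_finiteDimensional_span heK).isClosed heξ
  obtain ⟨v, hv⟩ := LinearMap.dualEmbedding_surjective (topDualPairing ℝ E) f
  have hv (ζ : E →L[ℝ] ℝ) : f (e ζ) = ζ v := (DFunLike.congr_fun hv (e ζ)).symm
  exact ⟨v, u, fun ζ hζ => (hv ζ).symm.trans_le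
    (hf _ (subset_convexHull ℝ _ (Set.mem_image_of_mem e hζ))).le, hu.trans_eq (hv ξ)⟩

/-- The functional `S ↦ ⟪j S φ, ψ⟫`, as a bilinear map of `φ` and `ψ`. -/
noncomputable def evalInner (j : E →L[ℝ] H →L[ℝ] H) : H →ₗ[ℝ] H →ₗ[ℝ] (E →L[ℝ] ℝ) :=
  LinearMap.mk₂ ℝ
    (fun φ ψ => (innerSL ℝ ψ).comp ((ContinuousLinearMap.apply ℝ H φ).comp j))
    (fun _ _ _ => by ext; simp)
    (fun _ _ _ => by ext; simp)
    (fun _ _ _ => by ext; simp)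
    (fun _ _ _ => by ext; simp)

theorem evalInner_apply (j : E →L[ℝ] H →L[ℝ] H) (φ ψ : H) (S : E) :
    evalInner j φ ψ S = ⟪j S φ, ψ⟫ := by
  simp [evalInner, real_inner_comm]

theorem continuous_evalInner (j : E →L[ℝ] H →L[ℝ] H) :
    Continuous fun φ : H => evalInner j φ φ := by
  have : Continuous fun φ : H =>
      (innerSL ℝ φ).comp ((ContinuousLinearMap.apply ℝ H φ).comp j) := by
    fun_prop
  exact this

/-- A functional outside the convex hull of the functionals `S ↦ ⟪j S φ, φ⟫`, with `φ` a unit vector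
of a finite-dimensional subspace, is strictly separated from them by some `S`. -/
theorem exists_separating_operator (j : E →L[ℝ] H →L[ℝ] H) (W : Submodule ℝ H)
    [FiniteDimensional ℝ W] {ξ : E →L[ℝ] ℝ}
    (hξ : ξ ∉ convexHull ℝ {ζ | ∃ φ ∈ W, ‖φ‖ = 1 ∧ evalInner j φ φ = ζ}) :
    ∃ (S : E) (u : ℝ), (∀ φ ∈ W, ‖φ‖ = 1 → ⟪j S φ, φ⟫ ≤ u) ∧ u < ξ S := by
  set K : Set (E →L[ℝ] ℝ) := {ζ | ∃ φ ∈ W, ‖φ‖ = 1 ∧ evalInner j φ φ = ζ} with hKdef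
  have hK : IsCompact K := by
    have hKeq : K = (fun φ : W => evalInner j (φ : H) φ) '' Metric.sphere 0 1 := by
      ext ζ
      simp [hKdef, and_left_comm]
    rw [hKeq]
    exact (isCompact_sphere _ _).image ((continuous_evalInner j).comp continuous_subtype_val)
  have hspan : FiniteDimensional ℝ (Submodule.span ℝ K) := by
    have hW : W.FG := (Submodule.fg_iff_finiteDimensional W).2 ‹_›
    have := (Submodule.fg_iff_finiteDimensional _).1 (hW.map₂ (evalInner j) hW)
    refine Submodule.finiteDimensional_of_le (S₂ := Submodule.map₂ (evalInner j) W W)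
      (Submodule.span_le.2 ?_)
    rintro _ ⟨φ, hφ, -, rfl⟩
    exact Submodule.apply_mem_map₂ _ hφ hφ
  obtain ⟨S, u, hS, hu⟩ := exists_forall_apply_le_lt_apply hK hξ
  exact ⟨S, u, fun φ hφ hφ1 => (evalInner_apply j φ φ S).symm.trans_le
    (hS _ ⟨φ, hφ, hφ1, rfl⟩), hu⟩

theorem eventually_abs_quotient_le {f : E → ℝ} (hf : ∀ S T, |f S - f T| ≤ ‖S - T‖) (x v : E) :
    ∀ᶠ p : E × ℝ in 𝓝 x ×ˢ 𝓝[>] (0 : ℝ), |(f (p.1 + p.2 • v) - f p.1) / p.2| ≤ ‖v‖ := by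
  have hpos : ∀ᶠ p : E × ℝ in 𝓝 x ×ˢ 𝓝[>] (0 : ℝ), 0 < p.2 :=
    tendsto_snd.eventually self_mem_nhdsWithin
  filter_upwards [hpos] with p hp
  rw [abs_div, abs_of_pos hp, div_le_iff₀ hp]
  refine (hf _ _).trans_eq ?_
  rw [add_sub_cancel_left, norm_smul, Real.norm_of_nonneg hp.le, mul_comm]

theorem clarkeDeriv_le {f : E → ℝ} (hf : ∀ S T, |f S - f T| ≤ ‖S - T‖) {x v : E} {a : ℝ}
    (h : ∀ᶠ p : E × ℝ in 𝓝 x ×ˢ 𝓝[>] (0 : ℝ), f (p.1 + p.2 • v) - f p.1 ≤ p.2 * a) :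
    clarkeDeriv f x v ≤ a := by
  have hpos : ∀ᶠ p : E × ℝ in 𝓝 x ×ˢ 𝓝[>] (0 : ℝ), 0 < p.2 :=
    tendsto_snd.eventually self_mem_nhdsWithin
  refine limsup_le_of_le (IsBoundedUnder.isCoboundedUnder_le ⟨-‖v‖, ?_⟩) ?_
  · exact (eventually_abs_quotient_le hf x v).mono fun p hp => (abs_le.1 hp).1
  · filter_upwards [h, hpos] with p hp hp0
    rwa [div_le_iff₀ hp0, mul_comm]

theorem le_clarkeDeriv {f : E → ℝ} (hf : ∀ S T, |f S - f T| ≤ ‖S - T‖) {x v : E} {a : ℝ}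
    (h : ∃ᶠ p : E × ℝ in 𝓝 x ×ˢ 𝓝[>] (0 : ℝ), p.2 * a ≤ f (p.1 + p.2 • v) - f p.1) :
    a ≤ clarkeDeriv f x v := by
  have hpos : ∀ᶠ p : E × ℝ in 𝓝 x ×ˢ 𝓝[>] (0 : ℝ), 0 < p.2 :=
    tendsto_snd.eventually self_mem_nhdsWithin
  refine le_limsup_of_frequently_le ((h.and_eventually hpos).mono fun p hp => ?_) ⟨‖v‖, ?_⟩
  · rw [le_div_iff₀ hp.2, mul_comm]
    exact hp.1
  · exact (eventually_abs_quotient_le hf x v).mono fun p hp => (abs_le.1 hp).2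

theorem convex_clarkeSubdiff (f : E → ℝ) (x : E) : Convex ℝ (clarkeSubdiff f x) := by
  intro ξ hξ ζ hζ a b ha hb hab v
  calc (a • ξ + b • ζ) v = a * ξ v + b * ζ v := by simp
    _ ≤ a * clarkeDeriv f x v + b * clarkeDeriv f x v :=
      add_le_add (mul_le_mul_of_nonneg_left (hξ v) ha) (mul_le_mul_of_nonneg_left (hζ v) hb)
    _ = clarkeDeriv f x v := by rw [← add_mul, hab, one_mul]

theorem clarkeDeriv_lamK_le (j : E →ₗᵢ[ℝ] H →L[ℝ] H)
    (hj : ∀ P, P ∈ Set.range j ↔ IsSelfAdjoint P ∧ IsCompactOperator P) {T S : E} {n : ℕ}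
    (hpos : 0 < lamK (j T) (n + 1)) {h : ℝ}
    (hS : ∀ φ, j T φ = lamK (j T) (n + 1) • φ → ⟪j S φ, φ⟫ ≤ h * ‖φ‖ ^ 2) :
    clarkeDeriv (fun X => lamK (j X) (n + 1)) T S ≤ h := by
  have hH := exists_finrank_eq_of_lamK_pos hpos
  have hjm (X : E) := (hj (j X)).1 ⟨X, rfl⟩
  have hf (X Y : E) : |lamK (j X) (n + 1) - lamK (j Y) (n + 1)| ≤ ‖X - Y‖ := by
    simpa [← map_sub] using abs_lamK_sub_le (by omega) hH (j X) (j Y)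
  refine le_of_forall_pos_le_add fun η hη => clarkeDeriv_le hf ?_
  set A := 3 * (‖j S‖ + |h|) with hA
  have hA0 : 0 ≤ A := by positivity
  set δ := min 1 (η / (A + 1)) with hδ
  have hδ0 : 0 < δ := by positivity
  have hAδ : A * δ ≤ η := by
    calc A * δ ≤ (A + 1) * (η / (A + 1)) := by
          gcongr
          · linarith
          · exact min_le_right _ _
      _ = η := by field_simp
  obtain ⟨r, hr, hnear⟩ := exists_near_eigenspace (hjm T).1 (hjm T).2 hpos hδ0
  have hX : ∀ᶠ p : E × ℝ in 𝓝 T ×ˢ 𝓝[>] (0 : ℝ), ‖T - p.1‖ ≤ r := by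
    have : ∀ᶠ X in 𝓝 T, ‖T - X‖ ≤ r := by
      filter_upwards [Metric.closedBall_mem_nhds T hr] with X hX
      rwa [← dist_eq_norm, dist_comm]
    exact tendsto_fst.eventually this
  have hY : ∀ᶠ p : E × ℝ in 𝓝 T ×ˢ 𝓝[>] (0 : ℝ), ‖p.1 + p.2 • S - T‖ ≤ r := by
    have hlim : Tendsto (fun p : E × ℝ => p.1 + p.2 • S) (𝓝 T ×ˢ 𝓝[>] (0 : ℝ)) (𝓝 T) := by
      have : Tendsto (fun p : E × ℝ => p.1 + p.2 • S) (𝓝 (T, 0)) (𝓝 (T + (0 : ℝ) • S)) :=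
        Continuous.tendsto (by fun_prop) (T, (0 : ℝ))
      rw [zero_smul, add_zero, nhds_prod_eq] at this
      exact this.mono_left (Filter.prod_mono le_rfl nhdsWithin_le_nhds)
    filter_upwards [hlim.eventually (Metric.closedBall_mem_nhds T hr)] with p hp
    rwa [← dist_eq_norm]
  have hpos : ∀ᶠ p : E × ℝ in 𝓝 T ×ˢ 𝓝[>] (0 : ℝ), 0 < p.2 :=
    tendsto_snd.eventually self_mem_nhdsWithin
  filter_upwards [hX, hY, hpos] with p hpX hpY hp0
  obtain ⟨φ, b, hφ, h1, h2, hb, hφb⟩ := hnear (j p.1) (j (p.1 + p.2 • S)) (hjm _).1 (hjm _).2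
    (hjm _).1 (hjm _).2 (by rwa [← map_sub, j.norm_map]) (by rwa [← map_sub, j.norm_map])
  have h3 : ⟪j S φ, φ⟫ ≤ h + η :=
    (inner_apply_le_of_near hφ (hS b hb) hφb (min_le_left _ _)).trans (by linarith)
  have h4 : ⟪j (p.1 + p.2 • S) φ, φ⟫ = ⟪j p.1 φ, φ⟫ + p.2 * ⟪j S φ, φ⟫ := by
    simp [inner_add_left, real_inner_smul_left]
  have h5 := mul_le_mul_of_nonneg_left h3 hp0.le
  linarith

theorem inner_apply_le_clarkeDeriv_lamK (j : E →ₗᵢ[ℝ] H →L[ℝ] H)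
    (hj : ∀ P, P ∈ Set.range j ↔ IsSelfAdjoint P ∧ IsCompactOperator P) {T S : E} {n : ℕ}
    (hpos : 0 < lamK (j T) (n + 1)) {φ : H} (hφ : ‖φ‖ = 1)
    (hTφ : j T φ = lamK (j T) (n + 1) • φ) :
    ⟪j S φ, φ⟫ ≤ clarkeDeriv (fun X => lamK (j X) (n + 1)) T S := by
  have hH := exists_finrank_eq_of_lamK_pos hpos
  have hjm (X : E) := (hj (j X)).1 ⟨X, rfl⟩
  have hf (X Y : E) : |lamK (j X) (n + 1) - lamK (j Y) (n + 1)| ≤ ‖X - Y‖ := by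
    simpa [← map_sub] using abs_lamK_sub_le (by omega) hH (j X) (j Y)
  refine le_of_forall_pos_le_add fun η hη => sub_le_iff_le_add.1 (le_clarkeDeriv hf ?_)
  obtain ⟨P, hP, hPc, hpert⟩ := exists_lamK_perturbation (hjm T).1 (hjm T).2 hpos hφ hTφ
  obtain ⟨P, rfl⟩ := (hj P).2 ⟨hP, hPc⟩
  intro hne
  have hcurve : Tendsto (fun ε : ℝ => T + ε • P) (𝓝[>] 0) (𝓝 T) := by
    have : Tendsto (fun ε : ℝ => T + ε • P) (𝓝 0) (𝓝 (T + (0 : ℝ) • P)) :=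
      Continuous.tendsto (by fun_prop) (0 : ℝ)
    rw [zero_smul, add_zero] at this
    exact this.mono_left nhdsWithin_le_nhds
  obtain ⟨ε, hε, hε0⟩ := ((hcurve.eventually hne.curry).and self_mem_nhdsWithin).exists
  obtain ⟨C, hC⟩ := hpert (j S) ε hε0
  have hsmall : ∀ᶠ t in 𝓝[>] (0 : ℝ), t < η / (|C| + 1) :=
    nhdsWithin_le_nhds (gt_mem_nhds (by positivity))
  obtain ⟨t, ⟨⟨ht1, ht2⟩, ht3⟩, ht0⟩ := (((hε.and hC).and hsmall).and self_mem_nhdsWithin).exists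
  have ht0 : 0 < t := ht0
  refine ht1 (le_trans ?_ (ht2.trans_eq ?_))
  · have h1 : t * (|C| + 1) < η := (lt_div_iff₀ (by positivity)).1 ht3
    have h2 : C * t ≤ η := by nlinarith [le_abs_self C]
    nlinarith
  · simp

/-- The Clarke subdifferential of `lamK` on a space `E` isometrically identified with the space of
compact self-adjoint operators. -/
theorem clarkeSubdiff_lamK (j : E →ₗᵢ[ℝ] H →L[ℝ] H)
    (hj : ∀ P, P ∈ Set.range j ↔ IsSelfAdjoint P ∧ IsCompactOperator P) {T : E} {n : ℕ}
    (hpos : 0 < lamK (j T) (n + 1)) :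
    clarkeSubdiff (fun X => lamK (j X) (n + 1)) T =
      convexHull ℝ {ξ : E →L[ℝ] ℝ | ∃ φ : H, ‖φ‖ = 1 ∧
        φ ∈ Module.End.eigenspace (j T : H →ₗ[ℝ] H) (lamK (j T) (n + 1)) ∧
        ∀ S : E, ξ S = ⟪j S φ, φ⟫} := by
  refine Set.Subset.antisymm (fun ξ hξ => ?_)
    (convexHull_min ?_ (convex_clarkeSubdiff _ _))
  · by_contra hn
    have hfin := ContinuousLinearMap.finite_dimensional_eigenspace ((hj (j T)).1 ⟨T, rfl⟩).2
      (lamK (j T) (n + 1)) hpos.ne'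
    obtain ⟨S, u, hS, hu⟩ := exists_separating_operator j.toContinuousLinearMap
      (Module.End.eigenspace (j T : H →ₗ[ℝ] H) (lamK (j T) (n + 1))) (ξ := ξ) fun hmem =>
      hn (convexHull_mono (by
        rintro _ ⟨φ, hφ, hφ1, rfl⟩
        exact ⟨φ, hφ1, hφ, fun S => evalInner_apply _ φ φ S⟩) hmem)
    refine hu.not_ge ((hξ S).trans (clarkeDeriv_lamK_le j hj hpos fun φ hφ => ?_))
    exact inner_apply_le_of_unit hS (Module.End.mem_eigenspace_iff.2 hφ)
  · rintro ξ ⟨φ, hφ1, hφ, hξ⟩ S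
    rw [hξ]
    exact inner_apply_le_clarkeDeriv_lamK j hj hpos hφ1 (Module.End.mem_eigenspace_iff.1 hφ)

theorem clarke_subdiff_eigenvalue (T₀ : Ksa H)
    (hpos : ∀ φ : H, 0 ≤ ⟪(T₀ : H →L[ℝ] H) φ, φ⟫)
    (k : ℕ) (hk : 1 ≤ k) (hlam : 0 < lamK (T₀ : H →L[ℝ] H) k) :
    (∃ (K : NNReal) (ε : ℝ), 0 < ε ∧
      LipschitzOnWith K (fun S : Ksa H => lamK (S : H →L[ℝ] H) k) (Metric.ball T₀ ε))
    ∧ clarkeSubdiff (fun S : Ksa H => lamK (S : H →L[ℝ] H) k) T₀ =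
        convexHull ℝ {ξ : Ksa H →L[ℝ] ℝ | ∃ φ : H, ‖φ‖ = 1 ∧
          φ ∈ Module.End.eigenspace ((T₀ : H →L[ℝ] H) : H →ₗ[ℝ] H)
            (lamK (T₀ : H →L[ℝ] H) k) ∧
          ∀ S : Ksa H, ξ S = ⟪(S : H →L[ℝ] H) φ, φ⟫} := by
  obtain ⟨n, rfl⟩ := Nat.exists_eq_add_of_le' hk
  refine ⟨⟨1, 1, one_pos, (LipschitzWith.of_dist_le_mul fun S T => ?_).lipschitzOnWith⟩, ?_⟩
  · rw [NNReal.coe_one, one_mul]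
    exact (abs_lamK_sub_le hk (exists_finrank_eq_of_lamK_pos hlam) S T).trans_eq
      (dist_eq_norm (S : H →L[ℝ] H) T).symm
  · have hrange (P : H →L[ℝ] H) : P ∈ Set.range (Ksa H).subtypeₗᵢ ↔
        IsSelfAdjoint P ∧ IsCompactOperator P := by
      rw [Submodule.coe_subtypeₗᵢ, Submodule.coe_subtype, Subtype.range_coe]
      rfl
    have := clarkeSubdiff_lamK (Ksa H).subtypeₗᵢ hrange (T := T₀) (n := n) hlam
    exact this
end
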